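/- Let X be a smooth projective geometrically connected curve over a perfect field k of cohomological dimension ≤ 1 with function field F. Two hereditary O_X-orders A₁ and A₂ in central simple F-algebras A₁^gen, A₂^gen are Morita equivalent if and only if A₁^gen and A₂^gen are Brauer-equivalent and e_x(A₁) = e_x(A₂) for all closed points x of X. -/

import Mathlib

set_option synthInstance.maxHeartbeats 1000000
set_option maxHeartbeats 1000000
open Pointwise

/-- An abstract model of a smooth projective geometrically connected curve over `k`:
its function field `F`, its set of closed points with residue degrees, and the discrete
valuations `ord x` attached to the closed points, satisfying the standard axioms
(including the product formula and `H⁰(X, O_X) = k`). -/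
structure AlgCurve (k : Type) [Field k] : Type 1 where
  F : Type
  [fieldF : Field F]
  [algkF : Algebra k F]
  Point : Type
  deg : Point → ℕ
  deg_pos : ∀ x, 0 < deg x
  ord : Point → F → ℤ
  ord_mul : ∀ (x) (a b : F), a ≠ 0 → b ≠ 0 → ord x (a * b) = ord x a + ord x b
  ord_neg : ∀ (x) (a : F), ord x (-a) = ord x a
  ord_add : ∀ (x) (a b : F), a ≠ 0 → b ≠ 0 → a + b ≠ 0 →
    min (ord x a) (ord x b) ≤ ord x (a + b)
  ord_exists_uniformizer : ∀ x, ∃ f : F, f ≠ 0 ∧ ord x f = 1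
  ord_algebraMap : ∀ (x) (c : k), c ≠ 0 → ord x (algebraMap k F c) = 0
  ord_support_finite : ∀ f : F, f ≠ 0 → {x | ord x f ≠ 0}.Finite
  product_formula : ∀ f : F, f ≠ 0 → ∀ s : Finset Point,
    {x | ord x f ≠ 0} ⊆ ↑s → ∑ x ∈ s, ord x f * (deg x : ℤ) = 0
  constants : ∀ f : F, f ≠ 0 → (∀ x, 0 ≤ ord x f) → ∃ c : k, algebraMap k F c = f

attribute [instance] AlgCurve.fieldF AlgCurve.algkF

namespace AlgCurve

variable {k : Type} [Field k] (C : AlgCurve k)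

lemma ord_one (x : C.Point) : C.ord x 1 = 0 := by
  have h := C.ord_mul x 1 1 one_ne_zero one_ne_zero
  rw [one_mul] at h; omega

/-- The local ring of the curve at a closed point `x`, as a subring of `F`. -/
def O (x : C.Point) : Subring C.F where
  carrier := {f | f = 0 ∨ 0 ≤ C.ord x f}
  zero_mem' := Or.inl rfl
  one_mem' := Or.inr (by rw [C.ord_one x])
  add_mem' := by
    rintro a b (rfl | ha) hb
    · simpa using hb
    rcases hb with rfl | hb
    · simpa using Or.inr ha
    by_cases hab : a + b = 0
    · exact Or.inl hab
    by_cases ha0 : a = 0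
    · subst ha0; simpa using Or.inr hb
    by_cases hb0 : b = 0
    · subst hb0; simpa using Or.inr ha
    refine Or.inr ?_
    have := C.ord_add x a b ha0 hb0 hab
    have hmin : (0:ℤ) ≤ min (C.ord x a) (C.ord x b) := le_min ha hb
    omega
  neg_mem' := by
    rintro a (rfl | ha)
    · simp
    · exact Or.inr (by rw [C.ord_neg x a]; exact ha)
  mul_mem' := by
    rintro a b (rfl | ha) hb
    · simp
    rcases hb with rfl | hb
    · simp
    by_cases ha0 : a = 0
    · subst ha0; simp
    by_cases hb0 : b = 0
    · subst hb0; simp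
    exact Or.inr (by rw [C.ord_mul x a b ha0 hb0]; omega)

end AlgCurve

/-- A family of lattices defining a locally free sheaf on the curve with generic fiber `V`. -/
def IsLatticeFamily {k : Type} [Field k] (C : AlgCurve k) (V : Type) [AddCommGroup V]
    [Module C.F V] (L : ∀ x : C.Point, Submodule ↥(C.O x) V) : Prop :=
  (∀ x, Module.Finite ↥(C.O x) ↥(L x)) ∧
  (∀ x, Submodule.span C.F ((L x : Set V)) = ⊤) ∧
  (∃ (n : ℕ) (g : Fin n → V), {x | L x ≠ Submodule.span ↥(C.O x) (Set.range g)}.Finite)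

def leftJacobson (R : Type) [Ring R] : Ideal R := (⊥ : Ideal R).jacobson

/-- The Jacobson radical of an order over a commutative base ring, as a submodule. -/
def radSubG (R A : Type) [CommRing R] [Ring A] [Algebra R A] (Λ : Subalgebra R A) :
    Submodule R A :=
  Submodule.map Λ.val.toLinearMap ((leftJacobson Λ).restrictScalars R)

/-- A sheaf of `O_X`-orders in the `F`-algebra `A`, given by its family of local orders. -/
structure SheafOrder {k : Type} [Field k] (C : AlgCurve k) (A : Type) [Ring A]
    [Algebra C.F A] : Type 1 where
  Λ : ∀ x : C.Point, Subalgebra ↥(C.O x) A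
  lattice : IsLatticeFamily C A (fun x => (Λ x).toSubmodule)

/-- The sheaf order is hereditary: all its local orders are hereditary. -/
def SheafOrder.IsHereditary {k : Type} [Field k] {C : AlgCurve k} {A : Type} [Ring A]
    [Algebra C.F A] (D : SheafOrder C A) : Prop :=
  ∀ x, ∀ I : Ideal (D.Λ x), Module.Projective (D.Λ x) I

/-- `e_x(D) = e`: the local order at `x` has index `e`, i.e. `rad^e = ϖ_x · Λ_x`. -/
def SheafOrder.HasIndexAt {k : Type} [Field k] {C : AlgCurve k} {A : Type} [Ring A]
    [Algebra C.F A] (D : SheafOrder C A) (x : C.Point) (e : ℕ) : Prop :=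
  ∃ ϖ : ↥(C.O x), C.ord x ϖ = 1 ∧
    (radSubG ↥(C.O x) A (D.Λ x)) ^ e = ϖ • (D.Λ x).toSubmodule

/-- The local order at `x` is principal: its radical is generated by one element. -/
def SheafOrder.IsPrincipalAt {k : Type} [Field k] {C : AlgCurve k} {A : Type} [Ring A]
    [Algebra C.F A] (D : SheafOrder C A) (x : C.Point) : Prop :=
  ∃ π : A, π ∈ D.Λ x ∧
    (D.Λ x).toSubmodule * Submodule.span ↥(C.O x) {π} = radSubG ↥(C.O x) A (D.Λ x) ∧
    Submodule.span ↥(C.O x) {π} * (D.Λ x).toSubmodule = radSubG ↥(C.O x) A (D.Λ x)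

/-!
Statement 15: Two hereditary `O_X`-orders `D₁ ⊆ A₁`, `D₂ ⊆ A₂` over a smooth projective
geometrically connected curve are Morita equivalent iff `A₁`, `A₂` are Brauer equivalent
and `e_x(D₁) = e_x(D₂)` for all closed points `x`.  Morita equivalence is formalized by
the existence of an invertible bimodule sheaf, given as a Morita context: generic
bimodules `I`, `J` with balanced pairings `μ`, `ν` which are associative and surjective,
together with compatible lattice families which are surjective locally at every point.
-/

/-- An invertible bimodule sheaf between two sheaf orders, presented as a Morita context
with lattice data. -/
structure MoritaContext {k : Type} [Field k] (C : AlgCurve k)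
    (A₁ : Type) [Ring A₁] [Algebra C.F A₁] (A₂ : Type) [Ring A₂] [Algebra C.F A₂]
    (D₁ : SheafOrder C A₁) (D₂ : SheafOrder C A₂) : Type 1 where
  I : Type
  J : Type
  [acgI : AddCommGroup I]
  [acgJ : AddCommGroup J]
  [modFI : Module C.F I]
  [modFJ : Module C.F J]
  [mod1I : Module A₁ I]
  [mod2I : Module A₂ᵐᵒᵖ I]
  [commI : SMulCommClass A₁ A₂ᵐᵒᵖ I]
  [tow1I : IsScalarTower C.F A₁ I]
  [tow2I : IsScalarTower C.F A₂ᵐᵒᵖ I]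
  [mod2J : Module A₂ J]
  [mod1J : Module A₁ᵐᵒᵖ J]
  [commJ : SMulCommClass A₂ A₁ᵐᵒᵖ J]
  [tow2J : IsScalarTower C.F A₂ J]
  [tow1J : IsScalarTower C.F A₁ᵐᵒᵖ J]
  μ : I → J → A₁
  ν : J → I → A₂
  μ_add_left : ∀ v v' w, μ (v + v') w = μ v w + μ v' w
  μ_add_right : ∀ v w w', μ v (w + w') = μ v w + μ v w'
  ν_add_left : ∀ w w' v, ν (w + w') v = ν w v + ν w' v
  ν_add_right : ∀ w v v', ν w (v + v') = ν w v + ν w v'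
  μ_smul_left : ∀ (a : A₁) v w, μ (a • v) w = a * μ v w
  μ_smul_right : ∀ (a : A₁) v w, μ v (MulOpposite.op a • w) = μ v w * a
  μ_balanced : ∀ (b : A₂) v w, μ (MulOpposite.op b • v) w = μ v (b • w)
  ν_smul_left : ∀ (b : A₂) w v, ν (b • w) v = b * ν w v
  ν_smul_right : ∀ (b : A₂) w v, ν w (MulOpposite.op b • v) = ν w v * b
  ν_balanced : ∀ (a : A₁) w v, ν (MulOpposite.op a • w) v = ν w (a • v)
  assoc₁ : ∀ v w v', μ v w • v' = MulOpposite.op (ν w v') • v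
  assoc₂ : ∀ w v w', ν w v • w' = MulOpposite.op (μ v w') • w
  μ_surjective : Submodule.span C.F {a : A₁ | ∃ v w, a = μ v w} = ⊤
  ν_surjective : Submodule.span C.F {b : A₂ | ∃ w v, b = ν w v} = ⊤
  LI : ∀ x : C.Point, Submodule ↥(C.O x) I
  LJ : ∀ x : C.Point, Submodule ↥(C.O x) J
  latticeI : IsLatticeFamily C I LI
  latticeJ : IsLatticeFamily C J LJ
  stabI_left : ∀ x, ∀ a ∈ D₁.Λ x, ∀ v ∈ LI x, a • v ∈ LI x
  stabI_right : ∀ x, ∀ b ∈ D₂.Λ x, ∀ v ∈ LI x, MulOpposite.op b • v ∈ LI x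
  stabJ_left : ∀ x, ∀ b ∈ D₂.Λ x, ∀ w ∈ LJ x, b • w ∈ LJ x
  stabJ_right : ∀ x, ∀ a ∈ D₁.Λ x, ∀ w ∈ LJ x, MulOpposite.op a • w ∈ LJ x
  μ_local : ∀ x, Submodule.span ↥(C.O x) {a : A₁ | ∃ v ∈ LI x, ∃ w ∈ LJ x, a = μ v w} =
    (D₁.Λ x).toSubmodule
  ν_local : ∀ x, Submodule.span ↥(C.O x) {b : A₂ | ∃ w ∈ LJ x, ∃ v ∈ LI x, b = ν w v} =
    (D₂.Λ x).toSubmodule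

/-- Brauer equivalence of central simple `F`-algebras. -/
def BrauerEquivalent (F A₁ A₂ : Type) [Field F] [Ring A₁] [Algebra F A₁] [Ring A₂]
    [Algebra F A₂] : Prop :=
  ∃ n m : ℕ, 0 < n ∧ 0 < m ∧
    Nonempty (Matrix (Fin n) (Fin n) A₁ ≃ₐ[F] Matrix (Fin m) (Fin m) A₂)

section JacobsonFacts

variable {R Λ : Type} [CommRing R] [IsLocalRing R] [Ring Λ] [Algebra R Λ] [Module.Finite R Λ]

lemma jac_mem_of_max (p : R) (hp : p ∈ IsLocalRing.maximalIdeal R) :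
    algebraMap R Λ p ∈ Ring.jacobson Λ := by
  rw [Ring.jacobson_eq_sInf_isMaximal, Ideal.mem_sInf]
  intro m hm
  by_contra hpm
  have hm' : m.IsMaximal := hm
  have h1 : m ⊔ Ideal.span {algebraMap R Λ p} = ⊤ := by
    apply hm'.1.2
    refine lt_of_le_of_ne le_sup_left ?_
    intro h
    apply hpm
    rw [h]
    exact Ideal.mem_sup_right (Ideal.mem_span_singleton_self _)
  have h2 : (⊤ : Submodule R Λ) ≤ m.restrictScalars R := by
    apply Submodule.le_of_le_smul_of_le_jacobson_bot (I := Ideal.span {p}) Module.Finite.fg_top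
    · rw [IsLocalRing.jacobson_eq_maximalIdeal _ bot_ne_top, Ideal.span_singleton_le_iff_mem]
      exact hp
    · intro x _
      have hx : x ∈ m ⊔ Ideal.span {algebraMap R Λ p} := by rw [h1]; trivial
      obtain ⟨y, hy, z, hz, rfl⟩ := Submodule.mem_sup.1 hx
      obtain ⟨a, rfl⟩ := Ideal.mem_span_singleton'.1 hz
      refine Submodule.add_mem_sup hy ?_
      rw [← Algebra.commutes, ← Algebra.smul_def]
      exact Submodule.smul_mem_smul (Ideal.mem_span_singleton_self p) trivial
  exact hm'.ne_top (by ext x; simpa using h2 (Submodule.mem_top (x := x)))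

lemma quot_artinian (p : R) (hp : IsLocalRing.maximalIdeal R = Ideal.span {p})
    (I : Ideal Λ) (hI : algebraMap R Λ p ∈ I) : IsArtinian Λ (Λ ⧸ I) := by
  have htor : Module.IsTorsionBySet R (Λ ⧸ I) (IsLocalRing.maximalIdeal R : Set R) := by
    rw [hp]
    refine (Module.isTorsionBySet_span_singleton_iff p).2 ?_
    intro x
    obtain ⟨y, rfl⟩ := Submodule.Quotient.mk_surjective _ x
    change Submodule.Quotient.mk (p • y) = _
    rw [Submodule.Quotient.mk_eq_zero, Algebra.smul_def, Algebra.commutes]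
    exact I.mul_mem_left _ hI
  let : Module (R ⧸ IsLocalRing.maximalIdeal R) (Λ ⧸ I) := htor.module
  let : Field (R ⧸ IsLocalRing.maximalIdeal R) := Ideal.Quotient.field _
  have : IsScalarTower R (R ⧸ IsLocalRing.maximalIdeal R) (Λ ⧸ I) :=
    htor.isScalarTower
  have : Module.Finite (R ⧸ IsLocalRing.maximalIdeal R) (Λ ⧸ I) :=
    Module.Finite.of_restrictScalars_finite R _ _
  have h1 : IsArtinian (R ⧸ IsLocalRing.maximalIdeal R) (Λ ⧸ I) := inferInstance
  let f : (Λ ⧸ I) →ₛₗ[Ideal.Quotient.mk (IsLocalRing.maximalIdeal R)] (Λ ⧸ I) :=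
    ⟨AddHom.id _, fun _ _ ↦ rfl⟩
  have h2 : IsArtinian R (Λ ⧸ I) := by
    have : RingHomSurjective (Ideal.Quotient.mk (IsLocalRing.maximalIdeal R)) :=
      ⟨Ideal.Quotient.mk_surjective⟩
    exact (f.isArtinian_iff_of_bijective Function.bijective_id).2 h1
  exact isArtinian_of_tower R h2

lemma quot_artinianRing (p : R) (hp : IsLocalRing.maximalIdeal R = Ideal.span {p})
    (I : Ideal Λ) [I.IsTwoSided] (hI : algebraMap R Λ p ∈ I) : IsArtinianRing (Λ ⧸ I) := by
  have h := quot_artinian p hp I hI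
  let f : (Λ ⧸ I) →ₛₗ[Ideal.Quotient.mk I] (Λ ⧸ I) :=
    ⟨AddHom.id _, fun _ _ ↦ rfl⟩
  have : RingHomSurjective (Ideal.Quotient.mk I) := ⟨Ideal.Quotient.mk_surjective⟩
  exact (f.isArtinian_iff_of_bijective Function.bijective_id).1 h

lemma jac_semisimple (p : R) (hp : IsLocalRing.maximalIdeal R = Ideal.span {p}) :
    IsSemisimpleRing (Λ ⧸ Ring.jacobson Λ) := by
  have := quot_artinianRing p hp (Ring.jacobson Λ)
    (jac_mem_of_max p (by rw [hp]; exact Ideal.mem_span_singleton_self p))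
  rw [IsArtinianRing.isSemisimpleRing_iff_jacobson]
  exact Ring.jacobson_quotient_jacobson Λ

lemma jac_left_identity (p : R) (hp : IsLocalRing.maximalIdeal R = Ideal.span {p})
    (X : Ideal Λ) [X.IsTwoSided] : ∃ c ∈ X, ∀ x ∈ X, (1 - c) * x ∈ Ring.jacobson Λ := by
  have := jac_semisimple (Λ := Λ) p hp
  let S := Λ ⧸ Ring.jacobson Λ
  let q : Λ →+* S := Ideal.Quotient.mk _
  let Y : Ideal Sᵐᵒᵖ :=
    { carrier := {s | ∃ x ∈ X, s = MulOpposite.op (q x)}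
      zero_mem' := ⟨0, X.zero_mem, by simp⟩
      add_mem' := by
        rintro _ _ ⟨x, hx, rfl⟩ ⟨y, hy, rfl⟩
        exact ⟨x + y, X.add_mem hx hy, by simp⟩
      smul_mem' := by
        rintro a _ ⟨x, hx, rfl⟩
        obtain ⟨b, hb⟩ := Ideal.Quotient.mk_surjective a.unop
        refine ⟨x * b, X.mul_mem_right _ hx, ?_⟩
        rw [map_mul, MulOpposite.op_mul, smul_eq_mul]
        congr 1
        change _ = MulOpposite.op (Ideal.Quotient.mk _ b)
        rw [hb]; rfl }
  obtain ⟨e, he, heY⟩ := IsSemisimpleRing.ideal_eq_span_idempotent Y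
  have heY' : e ∈ Y := by rw [heY]; exact Ideal.mem_span_singleton_self e
  obtain ⟨c, hc, rfl⟩ := heY'
  refine ⟨c, hc, fun x hx => ?_⟩
  have hxY : MulOpposite.op (q x) ∈ Y := ⟨x, hx, rfl⟩
  rw [heY] at hxY
  obtain ⟨a, ha⟩ := Ideal.mem_span_singleton'.1 hxY
  have h1 : q x = q c * a.unop := by
    have := congrArg MulOpposite.unop ha
    simpa using this.symm
  have hcc : q c * q c = q c := by
    have := congrArg MulOpposite.unop he.eq
    simpa using this
  rw [← Ideal.Quotient.eq_zero_iff_mem]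
  change q ((1 - c) * x) = 0
  rw [map_mul, map_sub, map_one, h1, sub_mul, one_mul, ← mul_assoc, hcc, sub_self]

lemma jac_pow_le (p : R) (hp : IsLocalRing.maximalIdeal R = Ideal.span {p}) :
    ∃ n : ℕ, 0 < n ∧ ∀ x ∈ (Ring.jacobson Λ) ^ n, ∃ y, x = p • y := by
  let I : Ideal Λ := Ideal.span {algebraMap R Λ p}
  have hImem : ∀ x, x ∈ I ↔ ∃ y, x = p • y := by
    intro x
    rw [Ideal.mem_span_singleton']
    constructor
    · rintro ⟨a, rfl⟩; exact ⟨a, by rw [Algebra.smul_def, Algebra.commutes]⟩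
    · rintro ⟨a, rfl⟩; exact ⟨a, by rw [Algebra.smul_def, Algebra.commutes]⟩
  have : I.IsTwoSided := ⟨fun b ha => by
    rw [hImem] at ha ⊢
    obtain ⟨y, rfl⟩ := ha
    exact ⟨y * b, by rw [smul_mul_assoc]⟩⟩
  have := quot_artinianRing p hp I (Ideal.mem_span_singleton_self _)
  obtain ⟨n, hn⟩ := IsSemiprimaryRing.isNilpotent (R := Λ ⧸ I)
  have key : ∀ k : ℕ, ∀ x ∈ (Ring.jacobson Λ) ^ k,
      Ideal.Quotient.mk I x ∈ (Ring.jacobson (Λ ⧸ I)) ^ k := by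
    intro k
    induction k with
    | zero => intro x _; rw [Submodule.pow_zero, Ideal.one_eq_top]; trivial
    | succ k ih =>
      intro x hx
      rw [Submodule.pow_succ] at hx ⊢
      refine Submodule.mul_induction_on hx ?_ ?_
      · intro a ha b hb
        rw [map_mul]
        exact Ideal.mul_mem_mul (ih a ha) (Ring.le_comap_jacobson (Ideal.Quotient.mk I) hb)
      · intro a b ha hb
        rw [map_add]; exact add_mem ha hb
  refine ⟨n + 1, Nat.succ_pos _, fun x hx => ?_⟩
  rw [← hImem, ← Ideal.Quotient.eq_zero_iff_mem]
  have := key _ x hx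
  rw [Submodule.pow_succ, hn] at this
  simpa using this

lemma jac_nakayama (X : Ideal Λ) (x j : Λ) (hx : x ∈ X) (hj : j ∈ Ring.jacobson Λ)
    (h : x + j = 1) : (1 : Λ) ∈ X := by
  by_contra hX
  obtain ⟨m, hm, hXm⟩ := Ideal.exists_le_maximal X ((Ideal.ne_top_iff_one X).2 hX)
  apply hm.ne_top
  rw [Ideal.eq_top_iff_one, ← h]
  exact m.add_mem (hXm hx) (Ring.jacobson_le_of_isMaximal m hj)

end JacobsonFacts

section LocalDefs

variable {R F B : Type} [CommRing R] [Field F] [Algebra R F] [Ring B] [Algebra F B] [Algebra R B]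
  [IsScalarTower R F B]

/-- The Peirce corner `e B f` (for idempotents). -/
def corner (R : Type) {B : Type} [CommRing R] [Ring B] [Algebra R B] (e f : B) :
    Submodule R B where
  carrier := {x | e * x = x ∧ x * f = x}
  zero_mem' := by simp
  add_mem' := by
    rintro a b ⟨h1, h2⟩ ⟨h3, h4⟩
    exact ⟨by rw [mul_add, h1, h3], by rw [add_mul, h2, h4]⟩
  smul_mem' := by
    rintro r x ⟨h1, h2⟩
    exact ⟨by rw [mul_smul_comm, h1], by rw [smul_mul_assoc, h2]⟩

lemma mem_corner {e f x : B} : x ∈ corner R e f ↔ e * x = x ∧ x * f = x := Iff.rfl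

/-- Left dual of a lattice. -/
def ldual (S : Submodule R B) (e f : B) (L : Submodule R B) : Submodule R B where
  carrier := {w | w ∈ corner R f e ∧ ∀ l ∈ L, l * w ∈ S}
  zero_mem' := ⟨zero_mem _, by simp⟩
  add_mem' := by
    rintro a b ⟨h1, h2⟩ ⟨h3, h4⟩
    exact ⟨add_mem h1 h3, fun l hl => by rw [mul_add]; exact add_mem (h2 l hl) (h4 l hl)⟩
  smul_mem' := by
    rintro r x ⟨h1, h2⟩
    exact ⟨Submodule.smul_mem _ _ h1, fun l hl => by
      rw [mul_smul_comm]; exact Submodule.smul_mem _ _ (h2 l hl)⟩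

lemma mem_ldual {S L : Submodule R B} {e f w : B} :
    w ∈ ldual S e f L ↔ w ∈ corner R f e ∧ ∀ l ∈ L, l * w ∈ S := Iff.rfl

lemma fcomm (a : F) (r : R) (x : B) : a • r • x = r • a • x := by
  rw [← algebraMap_smul F r x, ← algebraMap_smul F r (a • x), smul_smul, smul_smul, mul_comm]

/-- scaling of a submodule by an element of the fraction field -/
def fs (a : F) (X : Submodule R B) : Submodule R B where
  carrier := {y | ∃ x ∈ X, y = a • x}
  zero_mem' := ⟨0, zero_mem _, by simp⟩
  add_mem' := by
    rintro _ _ ⟨x, hx, rfl⟩ ⟨y, hy, rfl⟩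
    exact ⟨x + y, add_mem hx hy, by rw [smul_add]⟩
  smul_mem' := by
    rintro r _ ⟨x, hx, rfl⟩
    exact ⟨r • x, Submodule.smul_mem _ _ hx, (fcomm a r x).symm⟩

lemma mem_fs {a : F} {X : Submodule R B} {y : B} : y ∈ fs a X ↔ ∃ x ∈ X, y = a • x := Iff.rfl

lemma fs_mem {a : F} {X : Submodule R B} {x : B} (hx : x ∈ X) : a • x ∈ fs a X := ⟨x, hx, rfl⟩

lemma fs_mono (a : F) {X Y : Submodule R B} (h : X ≤ Y) : fs a X ≤ fs a Y := by
  rintro _ ⟨x, hx, rfl⟩; exact ⟨x, h hx, rfl⟩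

lemma fs_fs (a b : F) (X : Submodule R B) : fs a (fs b X) = fs (a * b) X := by
  ext y; constructor
  · rintro ⟨_, ⟨x, hx, rfl⟩, rfl⟩; exact ⟨x, hx, by rw [smul_smul]⟩
  · rintro ⟨x, hx, rfl⟩; exact ⟨b • x, ⟨x, hx, rfl⟩, by rw [smul_smul]⟩

lemma fs_one (X : Submodule R B) : fs (1 : F) X = X := by
  ext y; simp [mem_fs]

lemma fs_inv_cancel {a : F} (ha : a ≠ 0) (X : Submodule R B) : fs a⁻¹ (fs a X) = X := by
  rw [fs_fs, inv_mul_cancel₀ ha, fs_one]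

lemma fs_cancel_inv {a : F} (ha : a ≠ 0) (X : Submodule R B) : fs a (fs a⁻¹ X) = X := by
  rw [fs_fs, mul_inv_cancel₀ ha, fs_one]

lemma fs_mul (a : F) (X Y : Submodule R B) : fs a X * Y = fs a (X * Y) := by
  apply le_antisymm
  · rw [Submodule.mul_le]
    rintro _ ⟨x, hx, rfl⟩ y hy
    exact ⟨x * y, Submodule.mul_mem_mul hx hy, by rw [smul_mul_assoc]⟩
  · rintro _ ⟨z, hz, rfl⟩
    refine Submodule.mul_induction_on hz ?_ ?_
    · intro x hx y hy
      rw [← smul_mul_assoc]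
      exact Submodule.mul_mem_mul (fs_mem hx) hy
    · intro x y hx hy
      rw [smul_add]; exact add_mem hx hy

lemma mul_fs (a : F) (X Y : Submodule R B) : X * fs a Y = fs a (X * Y) := by
  apply le_antisymm
  · rw [Submodule.mul_le]
    rintro x hx _ ⟨y, hy, rfl⟩
    exact ⟨x * y, Submodule.mul_mem_mul hx hy, by rw [mul_smul_comm]⟩
  · rintro _ ⟨z, hz, rfl⟩
    refine Submodule.mul_induction_on hz ?_ ?_
    · intro x hx y hy
      rw [← mul_smul_comm]
      exact Submodule.mul_mem_mul hx (fs_mem hy)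
    · intro x y hx hy
      rw [smul_add]; exact add_mem hx hy

lemma fs_FG (a : F) {X : Submodule R B} (h : X.FG) : (fs a X).FG := by
  have : fs a X = X.map
      ({ toFun := fun x => a • x, map_add' := smul_add a, map_smul' := fun r x => fcomm a r x } :
        B →ₗ[R] B) := by
    ext y
    simp only [mem_fs, Submodule.mem_map, LinearMap.coe_mk, AddHom.coe_mk]
    constructor
    · rintro ⟨x, hx, rfl⟩; exact ⟨x, hx, rfl⟩
    · rintro ⟨x, hx, rfl⟩; exact ⟨x, hx, rfl⟩
  rw [this]; exact h.map _

/-- A hereditary order with identity `e` inside `e B e`, with radical `P`. -/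
structure HOrd (R : Type) {F B : Type} [CommRing R] [Field F] [Algebra R F] [Ring B] [Algebra F B]
    [Algebra R B] [IsScalarTower R F B] (π : F) (e : B) (S P : Submodule R B) : Prop where
  idem : e * e = e
  e_mem : e ∈ S
  S_le : S ≤ corner R e e
  SS : S * S ≤ S
  P_le : P ≤ S
  SP : S * P ≤ P
  PS : P * S ≤ P
  nak : ∀ X ≤ S, S * X ≤ X → e ∈ X ⊔ P → e ∈ X
  piS : fs π S ≤ P
  pw : ∃ n : ℕ, 0 < n ∧ P ^ n ≤ fs π S
  lid : ∀ X ≤ S, S * X ≤ X → X * S ≤ X → ∃ c ∈ X, ∀ x ∈ X, x - c * x ∈ P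
  one_not : e ∉ P
  full : ∀ x ∈ corner R e e, ∃ n : ℕ, π ^ n • x ∈ S
  fg : S.FG
  hered : ∀ (f : B) (L : Submodule R B), f * f = f → f ∈ corner R f e * corner R e f →
    L ≤ corner R e f → S * L ≤ L → L.FG → (∀ x ∈ corner R e f, ∃ n : ℕ, π ^ n • x ∈ L) →
    f ∈ ldual S e f L * L
  central : ∀ z ∈ corner R e e, (∀ s ∈ S, z * s = s * z) → ∃ a : F, z = a • e

end LocalDefs

namespace HOrd

variable {R F B : Type} [CommRing R] [Field F] [Algebra R F] [Ring B] [Algebra F B] [Algebra R B]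
  [IsScalarTower R F B] {π : F} {e : B} {S P : Submodule R B}

lemma e_mul (h : HOrd R π e S P) {x : B} (hx : x ∈ S) : e * x = x := (h.S_le hx).1
lemma mul_e (h : HOrd R π e S P) {x : B} (hx : x ∈ S) : x * e = x := (h.S_le hx).2

/-- If `e x = x` for all `x ∈ X`, then `X ≤ Y * X` when `e ∈ Y`. -/
lemma le_mul_left' {e : B} {X Y : Submodule R B} (he : e ∈ Y) (hX : ∀ x ∈ X, e * x = x) :
    X ≤ Y * X := fun x hx => by
  rw [← hX x hx]; exact Submodule.mul_mem_mul he hx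

lemma le_mul_right' {e : B} {X Y : Submodule R B} (he : e ∈ Y) (hX : ∀ x ∈ X, x * e = x) :
    X ≤ X * Y := fun x hx => by
  rw [← hX x hx]; exact Submodule.mul_mem_mul hx he

lemma SSeq (h : HOrd R π e S P) : S * S = S :=
  le_antisymm h.SS (le_mul_left' h.e_mem fun _ hx => h.e_mul hx)

lemma SPeq (h : HOrd R π e S P) : S * P = P :=
  le_antisymm h.SP (le_mul_left' h.e_mem fun _ hx => h.e_mul (h.P_le hx))

lemma PSeq (h : HOrd R π e S P) : P * S = P :=
  le_antisymm h.PS (le_mul_right' h.e_mem fun _ hx => h.mul_e (h.P_le hx))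

lemma eq_of_mem (h : HOrd R π e S P) {X : Submodule R B} (hX : X ≤ S) (hSX : S * X ≤ X)
    (he : e ∈ X) : X = S := by
  refine le_antisymm hX fun s hs => ?_
  rw [← h.mul_e hs]; exact hSX (Submodule.mul_mem_mul hs he)

lemma pow_le (h : HOrd R π e S P) {X : Submodule R B} (hX : X ≤ S) (n : ℕ) :
    X ^ (n + 1) ≤ S := by
  induction n with
  | zero => simpa using hX
  | succ n ih => rw [pow_succ]; exact (mul_le_mul' ih hX).trans h.SS

lemma semiprime (h : HOrd R π e S P) {N : Submodule R B} (hN : N ≤ S) (h1 : S * N ≤ N)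
    (h2 : N * S ≤ N) (n : ℕ) (hn : N ^ n ≤ P) : N ≤ P := by
  obtain ⟨c, hc, hcx⟩ := h.lid N hN h1 h2
  intro x hx
  have key : ∀ k : ℕ, x - c ^ k * x ∈ P := by
    intro k
    induction k with
    | zero => simp
    | succ k ih =>
      have : x - c ^ (k + 1) * x = (x - c * x) + c * (x - c ^ k * x) := by
        rw [pow_succ']; noncomm_ring
      rw [this]
      exact add_mem (hcx x hx) (h.SP (Submodule.mul_mem_mul (hN hc) ih))
  have h3 : c ^ n * x ∈ P := h.PS (Submodule.mul_mem_mul (hn (Submodule.pow_mem_pow N hc n)) (hN hx))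
  have := add_mem (key n) h3
  simpa using this

lemma corner_mul (e : B) : corner R e e * corner R e e ≤ corner R e e := by
  rw [Submodule.mul_le]
  rintro x ⟨h1, h2⟩ y ⟨h3, h4⟩
  exact ⟨by rw [← mul_assoc, h1], by rw [mul_assoc, h4]⟩

lemma e_self_corner (h : HOrd R π e S P) : e ∈ corner R e e * corner R e e := by
  have he : e ∈ corner R e e := h.S_le h.e_mem
  have := Submodule.mul_mem_mul he he
  rwa [h.idem] at this

lemma e_ne (h : HOrd R π e S P) : e ≠ 0 := fun h0 => h.one_not (h0 ▸ zero_mem P)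

lemma full_of_le (hπ : π ≠ 0) (h : HOrd R π e S P) {X : Submodule R B} (hX : fs π S ≤ X) :
    ∀ x ∈ corner R e e, ∃ n : ℕ, π ^ n • x ∈ X := by
  intro x hx
  obtain ⟨n, hn⟩ := h.full x hx
  exact ⟨n + 1, hX ⟨_, hn, by rw [pow_succ', smul_smul]⟩⟩

theorem P_inv [IsNoetherianRing R] (hπ : π ≠ 0) (h : HOrd R π e S P) :
    ∃ Pi : Submodule R B, Pi ≤ corner R e e ∧ Pi.FG ∧ P * Pi = S ∧ Pi * P = S ∧
      S * Pi = Pi ∧ Pi * S = Pi := by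
  set Pd := ldual S e e P with hPd
  have hPdc : Pd ≤ corner R e e := fun w hw => hw.1
  have hPPd : P * Pd ≤ S := by
    rw [Submodule.mul_le]; intro m hm n hn; exact hn.2 m hm
  have hfgP : P.FG := h.fg.of_le h.P_le
  have hcc := corner_mul (R := R) e
  have hPdS : Pd * S ≤ Pd := by
    rw [Submodule.mul_le]; intro m hm n hn
    refine ⟨hcc (Submodule.mul_mem_mul hm.1 (h.S_le hn)), fun l hl => ?_⟩
    rw [← mul_assoc]; exact h.SS (Submodule.mul_mem_mul (hm.2 l hl) hn)
  have hSPd : S * Pd ≤ Pd := by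
    rw [Submodule.mul_le]; intro m hm n hn
    refine ⟨hcc (Submodule.mul_mem_mul (h.S_le hm) hn.1), fun l hl => ?_⟩
    rw [← mul_assoc]; exact hn.2 _ (h.PS (Submodule.mul_mem_mul hl hm))
  have hePd : e ∈ Pd := ⟨h.S_le h.e_mem, fun l hl => by
    rw [h.mul_e (h.P_le hl)]; exact h.P_le hl⟩
  have hSPdeq : S * Pd = Pd := le_antisymm hSPd (le_mul_left' h.e_mem fun x hx => (hPdc hx).1)
  have hPdSeq : Pd * S = Pd := le_antisymm hPdS (le_mul_right' h.e_mem fun x hx => (hPdc hx).2)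
  have hPdfg : Pd.FG := by
    refine (fs_FG π⁻¹ h.fg).of_le ?_
    rw [← fs_inv_cancel hπ Pd]
    refine fs_mono _ ?_
    rw [← hSPdeq, ← fs_mul]
    exact (mul_le_mul_left h.piS _).trans hPPd
  have hePdP : e ∈ Pd * P := h.hered e P h.idem h.e_self_corner (h.P_le.trans h.S_le) h.SP hfgP
    (h.full_of_le hπ h.piS)
  -- the trace ideal
  set T := P * Pd with hT
  have hST : S * T ≤ T := by rw [hT, ← mul_assoc, h.SPeq]
  have hTS : T * S ≤ T := by rw [hT, mul_assoc, hPdSeq]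
  have hPT : P ≤ T := le_mul_right' hePd fun x hx => h.mul_e (h.P_le hx)
  have hTP : P ≤ T * P := by
    rw [hT, mul_assoc]; exact le_mul_right' hePdP fun x hx => h.mul_e (h.P_le hx)
  have hTT : T ≤ T * T := by
    have : T * T = P * ((Pd * P) * Pd) := by rw [hT]; simp only [mul_assoc]
    rw [this]
    exact mul_le_mul_right (le_mul_left' hePdP fun x hx => (hPdc hx).1) _
  obtain ⟨c, hcT, hc⟩ := h.lid T hPPd hST hTS
  have hPTT : P * T ≤ T := (mul_le_mul_left h.P_le _).trans hST
  let M : ℕ → Submodule R B := fun n => fs π S ⊔ P ^ n * T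
  have hM0 : M 0 = T := by
    simp only [M, pow_zero, one_mul]
    exact sup_eq_right.2 (h.piS.trans hPT)
  have hMsucc : ∀ n, M (n + 1) ≤ M n := fun n => by
    refine sup_le_sup le_rfl ?_
    rw [pow_succ, mul_assoc]
    exact mul_le_mul_right hPTT _
  have hPM : ∀ n, P * M n ≤ M (n + 1) := fun n => by
    simp only [M]
    rw [Submodule.mul_sup, ← mul_assoc, ← pow_succ', mul_fs, h.PSeq]
    exact sup_le_sup (fs_mono _ h.P_le) le_rfl
  have hMT : ∀ n, M n ≤ T * M n := by
    intro n
    induction n with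
    | zero => rw [hM0]; exact hTT
    | succ n ih =>
      intro x hx
      have h1 : x ∈ T * M n := ih (hMsucc n hx)
      have h2 : ∀ y ∈ T * M n, y - c * y ∈ P * M n := by
        intro y hy
        refine Submodule.mul_induction_on hy ?_ ?_
        · intro t ht m hm
          have : t * m - c * (t * m) = (t - c * t) * m := by noncomm_ring
          rw [this]; exact Submodule.mul_mem_mul (hc t ht) hm
        · intro a b ha hb
          have : a + b - c * (a + b) = (a - c * a) + (b - c * b) := by noncomm_ring
          rw [this]; exact add_mem ha hb
      have h3 : P * M n ≤ T * M (n + 1) :=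
        (mul_le_mul_left hTP _).trans (by rw [mul_assoc]; exact mul_le_mul_right (hPM n) _)
      have := add_mem (h3 (h2 x h1)) (Submodule.mul_mem_mul hcT hx)
      simpa using this
  obtain ⟨n, hn0, hn⟩ := h.pw
  have hMn : M n = fs π S := by
    refine sup_eq_left.2 ?_
    refine (mul_le_mul' hn hPPd).trans ?_
    rw [fs_mul]; exact fs_mono _ h.SS
  have heT : e ∈ T := by
    have h1 := hMT n
    rw [hMn, mul_fs] at h1
    have h2 := fs_mono π⁻¹ h1
    rw [fs_inv_cancel hπ, fs_inv_cancel hπ] at h2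
    exact hTS (h2 h.e_mem)
  have hTS' : T = S := h.eq_of_mem hPPd hST heT
  -- other side
  set G := Pd * P with hG
  have hGc : G ≤ corner R e e := (mul_le_mul' hPdc (h.P_le.trans h.S_le)).trans hcc
  have hGS : G * S ≤ G := by rw [hG, mul_assoc, h.PSeq]
  have hSG : S * G ≤ G := by rw [hG, ← mul_assoc, hSPdeq]
  have hPG : P * G ≤ P := by rw [hG, ← mul_assoc, ← hT, hTS', h.SPeq]
  have hSleG : S ≤ G := (le_mul_right' hePdP fun x hx => h.mul_e hx).trans hSG
  set D := ldual S e e G with hD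
  have hDS : D ≤ S := fun w hw => by
    have := hw.2 e hePdP
    rwa [(hw.1).1] at this
  have hD1 : S * D ≤ D := by
    rw [Submodule.mul_le]; intro m hm n hn
    refine ⟨hcc (Submodule.mul_mem_mul (h.S_le hm) hn.1), fun l hl => ?_⟩
    rw [← mul_assoc]; exact hn.2 _ (hGS (Submodule.mul_mem_mul hl hm))
  have hD2 : D * S ≤ D := by
    rw [Submodule.mul_le]; intro m hm n hn
    refine ⟨hcc (Submodule.mul_mem_mul hm.1 (h.S_le hn)), fun l hl => ?_⟩
    rw [← mul_assoc]; exact h.SS (Submodule.mul_mem_mul (hm.2 l hl) hn)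
  have heDG : e ∈ D * G := h.hered e G h.idem h.e_self_corner hGc hSG (hPdfg.mul hfgP)
    (fun x hx => (h.full x hx).imp fun n hn => hSleG hn)
  obtain ⟨d, hdD, hd⟩ := h.lid D hDS hD1 hD2
  have hed : ∀ y ∈ D * G, y - d * y ∈ P := by
    intro y hy
    refine Submodule.mul_induction_on hy ?_ ?_
    · intro t ht m hm
      have : t * m - d * (t * m) = (t - d * t) * m := by noncomm_ring
      rw [this]; exact hPG (Submodule.mul_mem_mul (hd t ht) hm)
    · intro a b ha hb
      have : a + b - d * (a + b) = (a - d * a) + (b - d * b) := by noncomm_ring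
      rw [this]; exact add_mem ha hb
  have heD : e ∈ D := by
    refine h.nak D hDS hD1 ?_
    have h1 := hed e heDG
    rw [h.mul_e (hDS hdD)] at h1
    have := Submodule.add_mem_sup hdD h1
    simpa using this
  have hGS' : G ≤ S := fun g hg => by
    have := heD.2 g hg
    rwa [(hGc hg).2] at this
  exact ⟨Pd, hPdc, hPdfg, hTS', le_antisymm hGS' hSleG, hSPdeq, hPdSeq⟩

end HOrd

namespace HOrd

variable {R F B : Type} [CommRing R] [IsDomain R] [IsDiscreteValuationRing R]
  [Field F] [Algebra R F] [IsFractionRing R F] [Ring B] [Algebra F B] [Algebra R B]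
  [IsScalarTower R F B] {p : R} {e : B} {S P : Submodule R B}


lemma integral_scalar (hp : IsLocalRing.maximalIdeal R = Ideal.span {p})
    (h : HOrd R (algebraMap R F p) e S P) (a : F) (ha : a • e ∈ S) :
    ∃ r : R, algebraMap R F r = a := by
  by_cases ha0 : a = 0
  · exact ⟨0, by rw [map_zero, ha0]⟩
  rcases ValuationRing.isInteger_or_isInteger R a with h1 | ⟨r, hr⟩
  · exact h1
  by_cases hu : IsUnit r
  · obtain ⟨u, rfl⟩ := hu
    refine ⟨((u⁻¹ : Rˣ) : R), ?_⟩
    rw [← inv_inv a, ← hr]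
    rw [← map_units_inv]
  · exfalso
    have : r ∈ IsLocalRing.maximalIdeal R := hu
    rw [hp, Ideal.mem_span_singleton'] at this
    obtain ⟨t, rfl⟩ := this
    apply h.one_not
    apply h.piS
    refine ⟨algebraMap R F t • a • e, ?_, ?_⟩
    · rw [algebraMap_smul]; exact S.smul_mem _ ha
    · rw [smul_smul, smul_smul, ← map_mul, mul_comm p t, hr, inv_mul_cancel₀ ha0, one_smul]

lemma lemmaZ (hp : IsLocalRing.maximalIdeal R = Ideal.span {p})
    (h : HOrd R (algebraMap R F p) e S P) :
    ∃ N : ℕ, ∀ b ∈ S, (∀ s ∈ S, b * s - s * b ∈ fs ((algebraMap R F p) ^ N) S) →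
      ∃ r : R, ∃ s ∈ S, b = r • e + p • s := by
  obtain ⟨n, g, hg⟩ := Submodule.fg_iff_exists_fin_generating_family.1 h.fg
  have hgS : ∀ i, g i ∈ S := fun i => hg ▸ Submodule.subset_span ⟨i, rfl⟩
  have hmul : ∀ a ∈ S, ∀ b ∈ S, a * b ∈ S := fun a ha b hb => h.SS (Submodule.mul_mem_mul ha hb)
  have hfin : Module.Finite R S := Module.Finite.iff_fg.2 h.fg
  let φ : S →ₗ[R] (Fin n → S) :=
    { toFun := fun b i => ⟨b * g i - g i * b, sub_mem (hmul _ b.2 _ (hgS i)) (hmul _ (hgS i) _ b.2)⟩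
      map_add' := by
        intro a b; ext i
        simp only [Submodule.coe_add, Pi.add_apply]; noncomm_ring
      map_smul' := by
        intro r b; ext i
        simp only [Submodule.coe_smul, Pi.smul_apply, RingHom.id_apply, smul_mul_assoc,
          mul_smul_comm, smul_sub] }
  obtain ⟨k, hk⟩ := Ideal.exists_pow_inf_eq_pow_smul (Ideal.span {p}) (LinearMap.range φ)
  refine ⟨k + 1, fun b hb hbs => ?_⟩
  have h1 : φ ⟨b, hb⟩ ∈ (Ideal.span {p} ^ (k + 1) • ⊤ ⊓ LinearMap.range φ :
      Submodule R (Fin n → S)) := by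
    refine ⟨?_, ⟨_, rfl⟩⟩
    choose t ht hbt using fun i => hbs (g i) (hgS i)
    have : φ ⟨b, hb⟩ = p ^ (k + 1) • (fun i => (⟨t i, ht i⟩ : S)) := by
      ext i
      change b * g i - g i * b = p ^ (k + 1) • t i
      rw [hbt i, ← map_pow, algebraMap_smul]
    rw [this]
    exact Submodule.smul_mem_smul (Ideal.pow_mem_pow (Ideal.mem_span_singleton_self p) _) trivial
  rw [hk (k + 1) (Nat.le_succ k), Nat.add_sub_cancel_left, pow_one] at h1
  have h2 : _ ∈ Ideal.span {p} • LinearMap.range φ := Submodule.smul_mono le_rfl inf_le_right h1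
  rw [Submodule.ideal_span_singleton_smul] at h2
  obtain ⟨_, ⟨s, rfl⟩, hs⟩ := Submodule.mem_smul_pointwise_iff_exists _ _ _ |>.1 h2
  have hker : φ (⟨b, hb⟩ - p • s) = 0 := by rw [map_sub, map_smul, hs, sub_self]
  have hcg : ∀ i, (b - p • (s : B)) * g i = g i * (b - p • (s : B)) := fun i => by
    have := congrArg (fun f => ((f i : S) : B)) hker
    exact sub_eq_zero.1 this
  have hcs : ∀ x ∈ S, (b - p • (s : B)) * x = x * (b - p • (s : B)) := by
    intro x hx
    rw [← hg] at hx
    induction hx using Submodule.span_induction with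
    | mem x hx => obtain ⟨i, rfl⟩ := hx; exact hcg i
    | zero => simp
    | add x y _ _ hx hy => rw [mul_add, add_mul, hx, hy]
    | smul r x _ hx => rw [mul_smul_comm, smul_mul_assoc, hx]
  have hbS : b - p • (s : B) ∈ S := sub_mem hb (S.smul_mem _ s.2)
  obtain ⟨a, ha⟩ := h.central _ (h.S_le hbS) hcs
  obtain ⟨r, rfl⟩ := h.integral_scalar hp a (ha ▸ hbS)
  refine ⟨r, s, s.2, ?_⟩
  rw [algebraMap_smul] at ha
  rw [← ha, sub_add_cancel]

lemma fs_pow_le {π : F} (h : HOrd R π e S P) (N : ℕ) : (fs π S) ^ (N + 1) ≤ fs (π ^ (N + 1)) S := by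
  induction N with
  | zero => simp
  | succ N ih =>
    rw [pow_succ]
    refine (mul_le_mul_left ih _).trans ?_
    rw [fs_mul, mul_fs, fs_fs, ← pow_succ]
    exact fs_mono _ h.SS

theorem lemmaC (hp : IsLocalRing.maximalIdeal R = Ideal.span {p})
    (h : HOrd R (algebraMap R F p) e S P) {X : Submodule R B} (hX : X ≤ S)
    (hSX : S * X ≤ X) (hXS : X * S ≤ X) (hPX : P * X = X * P) : X ≤ P ∨ e ∈ X := by
  obtain ⟨I, hI⟩ : ∃ I, I = X ⊔ P := ⟨_, rfl⟩
  obtain ⟨I', hI'⟩ : ∃ I' : Submodule R B, ∀ l, l ∈ I' ↔ (l ∈ S ∧ ∀ x ∈ X, l * x ∈ P) := ⟨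
    { carrier := {l | l ∈ S ∧ ∀ x ∈ X, l * x ∈ P}
      zero_mem' := ⟨zero_mem _, by simp⟩
      add_mem' := by
        rintro a b ⟨h1, h2⟩ ⟨h3, h4⟩
        exact ⟨add_mem h1 h3, fun x hx => by rw [add_mul]; exact add_mem (h2 x hx) (h4 x hx)⟩
      smul_mem' := by
        rintro r a ⟨h1, h2⟩
        exact ⟨S.smul_mem _ h1, fun x hx => by
          rw [smul_mul_assoc]; exact P.smul_mem _ (h2 x hx)⟩ }, fun l => Iff.rfl⟩
  have hI'S : I' ≤ S := fun x hx => ((hI' x).1 hx).1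
  have hIS : I ≤ S := by rw [hI]; exact sup_le hX h.P_le
  have hI'X : I' * X ≤ P := by
    rw [Submodule.mul_le]; intro a ha b hb; exact ((hI' a).1 ha).2 b hb
  have hI'I : I' * I ≤ P := by
    rw [hI, Submodule.mul_sup]
    exact sup_le hI'X ((mul_le_mul_left hI'S _).trans h.SP)
  have hSI : S * I ≤ I := by
    rw [hI, Submodule.mul_sup]; exact sup_le_sup hSX h.SP
  have hIS2 : I * S ≤ I := by
    rw [hI, Submodule.sup_mul]; exact sup_le_sup hXS h.PS
  have hSI' : S * I' ≤ I' := by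
    rw [Submodule.mul_le]; intro a ha b hb
    rw [hI'] at hb ⊢
    refine ⟨h.SS (Submodule.mul_mem_mul ha hb.1), fun x hx => ?_⟩
    rw [mul_assoc]; exact h.SP (Submodule.mul_mem_mul ha (hb.2 x hx))
  have hI'S2 : I' * S ≤ I' := by
    rw [Submodule.mul_le]; intro a ha b hb
    rw [hI'] at ha ⊢
    refine ⟨h.SS (Submodule.mul_mem_mul ha.1 hb), fun x hx => ?_⟩
    rw [mul_assoc]; exact ha.2 _ (hSX (Submodule.mul_mem_mul hb hx))
  have hII' : I * I' ≤ P := by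
    refine h.semiprime ((mul_le_mul' hIS hI'S).trans h.SS) ?_ ?_ 2 ?_
    · rw [← mul_assoc]; exact mul_le_mul_left hSI _
    · rw [mul_assoc]; exact mul_le_mul_right hI'S2 _
    · have : (I * I') ^ 2 = I * (I' * I) * I' := by rw [pow_two]; simp only [mul_assoc]
      rw [this]
      exact (mul_le_mul' (mul_le_mul' hIS hI'I) hI'S).trans
        ((mul_le_mul_left h.SP _).trans h.PS)
  obtain ⟨c, hcX, hc⟩ := h.lid X hX hSX hXS
  have hec : e - c ∈ I' := by
    rw [hI']
    refine ⟨sub_mem h.e_mem (hX hcX), fun x hx => ?_⟩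
    rw [sub_mul, h.e_mul (hX hx)]; exact hc x hx
  have hPI' : P ≤ I' := fun x hx =>
    (hI' x).2 ⟨h.P_le hx, fun y hy => h.PS (Submodule.mul_mem_mul hx (hX hy))⟩
  have hPI : P * I = I * P := by rw [hI, Submodule.mul_sup, Submodule.sup_mul, hPX]
  have hcomm : ∀ m : ℕ, P * I ^ m = I ^ m * P := fun m => ((show Commute P I from hPI).pow_right m).eq
  have hm1 : ∀ m : ℕ, I ^ (m + 1) * I' ^ (m + 1) ≤ P ^ (m + 1) := by
    intro m
    induction m with
    | zero => simpa using hII'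
    | succ m ih =>
      have : I ^ (m + 1 + 1) * I' ^ (m + 1 + 1) = I ^ (m + 1) * (I * I') * I' ^ (m + 1) := by
        rw [pow_succ I, pow_succ' I']; simp only [mul_assoc]
      rw [this]
      refine (mul_le_mul_left (mul_le_mul_right hII' _) _).trans ?_
      rw [← hcomm, mul_assoc, pow_succ' P]
      exact mul_le_mul_right ih _
  have hm2 : ∀ m : ℕ, I' ^ (m + 1) * I ^ (m + 1) ≤ P ^ (m + 1) := by
    intro m
    induction m with
    | zero => simpa using hI'I
    | succ m ih =>
      have : I' ^ (m + 1 + 1) * I ^ (m + 1 + 1) = I' ^ (m + 1) * (I' * I) * I ^ (m + 1) := by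
        rw [pow_succ I', pow_succ' I]; simp only [mul_assoc]
      rw [this]
      refine (mul_le_mul_left (mul_le_mul_right hI'I _) _).trans ?_
      rw [mul_assoc, hcomm, ← mul_assoc, pow_succ P]
      exact mul_le_mul_left ih _
  have hepow : ∀ m : ℕ, I ^ (m + 1) ≤ I ∧ I' ^ (m + 1) ≤ I' := by
    intro m
    induction m with
    | zero => simp
    | succ m ih =>
      rw [pow_succ, pow_succ]
      exact ⟨(mul_le_mul' ih.1 hIS).trans hIS2, (mul_le_mul' ih.2 hI'S).trans hI'S2⟩
  have he0 : e ∈ I ⊔ I' := by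
    have := Submodule.add_mem_sup (S := I) (T := I') (hI ▸ Submodule.mem_sup_left hcX) hec
    simpa using this
  have he1 : ∀ m : ℕ, e ∈ I ⊔ I' ^ (m + 1) := by
    intro m
    induction m with
    | zero => simpa using he0
    | succ m ih =>
      have := Submodule.mul_mem_mul ih he0
      rw [h.idem, Submodule.sup_mul, Submodule.mul_sup, Submodule.mul_sup] at this
      refine (sup_le (sup_le ?_ ?_) (sup_le ?_ ?_) : _ ≤ I ⊔ I' ^ (m + 1 + 1)) this
      · exact le_sup_of_le_left ((mul_le_mul_right hIS _).trans hIS2)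
      · exact le_sup_of_le_left ((mul_le_mul_right hI'S _).trans hIS2)
      · exact le_sup_of_le_left ((mul_le_mul_left ((hepow m).2.trans hI'S) _).trans hSI)
      · rw [pow_succ _ (m + 1)]; exact le_sup_right
  have he2 : ∀ m l : ℕ, e ∈ I ^ (l + 1) ⊔ I' ^ (m + 1) := by
    intro m l
    induction l with
    | zero => simpa using he1 m
    | succ l ih =>
      have := Submodule.mul_mem_mul ih (he1 m)
      rw [h.idem, Submodule.sup_mul, Submodule.mul_sup, Submodule.mul_sup] at this
      have hIm : I' ^ (m + 1) * S ≤ I' ^ (m + 1) := by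
        rw [pow_succ, mul_assoc]; exact mul_le_mul_right hI'S2 _
      have hSIm : S * I' ^ (m + 1) ≤ I' ^ (m + 1) := by
        rw [pow_succ', ← mul_assoc]; exact mul_le_mul_left hSI' _
      refine (sup_le (sup_le ?_ ?_) (sup_le ?_ ?_) : _ ≤ I ^ (l + 1 + 1) ⊔ I' ^ (m + 1)) this
      · rw [pow_succ _ (l + 1)]; exact le_sup_left
      · exact le_sup_of_le_right ((mul_le_mul_left ((hepow l).1.trans hIS) _).trans hSIm)
      · exact le_sup_of_le_right ((mul_le_mul_right hIS _).trans hIm)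
      · exact le_sup_of_le_right ((mul_le_mul_right ((hepow m).2.trans hI'S) _).trans hIm)
  obtain ⟨N, hN⟩ := h.lemmaZ hp
  obtain ⟨n, hn0, hn⟩ := h.pw
  obtain ⟨m, hm⟩ : ∃ m, m + 1 = n * (N + 1) := ⟨n * (N + 1) - 1, by
    have : 0 < n * (N + 1) := by positivity
    omega⟩
  have hPm : P ^ (m + 1) ≤ fs ((algebraMap R F p) ^ N) S := by
    rw [hm, pow_mul]
    refine (pow_le_pow_left' hn (N + 1)).trans ?_
    refine (h.fs_pow_le N).trans ?_
    rw [pow_succ, ← fs_fs]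
    exact fs_mono _ (h.piS.trans h.P_le)
  obtain ⟨u, hu, v, hv, huv⟩ := Submodule.mem_sup.1 (he2 m m)
  have huI := (hepow m).1 hu
  have hvI := (hepow m).2 hv
  obtain ⟨r, s, hs, hus⟩ := hN u (hIS huI) (by
    intro s hs
    apply hPm
    have h1 : u * s - s * u = u * (s * v) - v * (s * u) := by
      have e1 : u * s = u * (s * (u + v)) := by rw [huv, h.mul_e hs]
      have e2 : s * u = (u + v) * (s * u) := by
        rw [huv, ← mul_assoc, h.e_mul hs]
      have e3 : u * s - s * u = u * (s * (u + v)) - (u + v) * (s * u) := by rw [← e1, ← e2]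
      rw [e3]; noncomm_ring
    rw [h1]
    have hsv : s * v ∈ I' ^ (m + 1) := by
      have : S * I' ^ (m + 1) ≤ I' ^ (m + 1) := by
        rw [pow_succ', ← mul_assoc]; exact mul_le_mul_left hSI' _
      exact this (Submodule.mul_mem_mul hs hv)
    have hsu : s * u ∈ I ^ (m + 1) := by
      have : S * I ^ (m + 1) ≤ I ^ (m + 1) := by
        rw [pow_succ', ← mul_assoc]; exact mul_le_mul_left hSI _
      exact this (Submodule.mul_mem_mul hs hu)
    exact sub_mem (hm1 m (Submodule.mul_mem_mul hu hsv)) (hm2 m (Submodule.mul_mem_mul hv hsu)))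
  have hpS : ∀ s ∈ S, p • s ∈ P := fun s hs => h.piS ⟨s, hs, by rw [algebraMap_smul]⟩
  by_cases hr : IsUnit r
  · right
    obtain ⟨w, rfl⟩ := hr
    refine h.nak X hX hSX ?_
    have h1 : (w : R) • e ∈ I := by
      have : (w : R) • e = u - p • s := by rw [hus]; abel
      rw [this]
      exact sub_mem huI (hI ▸ Submodule.mem_sup_right (hpS s hs))
    have := I.smul_mem ((w⁻¹ : Rˣ) : R) h1
    rwa [smul_smul, Units.inv_mul, one_smul, hI] at this
  · left
    have : r ∈ IsLocalRing.maximalIdeal R := hr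
    rw [hp, Ideal.mem_span_singleton'] at this
    obtain ⟨t, rfl⟩ := this
    have huP : u ∈ P := by
      rw [hus, mul_comm, mul_smul]
      exact add_mem (hpS _ (S.smul_mem _ h.e_mem)) (hpS s hs)
    have he : e ∈ I' := by rw [← huv]; exact add_mem (hPI' huP) hvI
    intro x hx
    have := ((hI' e).1 he).2 x hx
    rwa [h.e_mul (hX hx)] at this

theorem exists_index (hp : IsLocalRing.maximalIdeal R = Ideal.span {p}) (hp0 : p ≠ 0)
    (h : HOrd R (algebraMap R F p) e S P) :
    ∃ E : ℕ, P ^ (E + 1) = fs (algebraMap R F p) S := by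
  have hπ : algebraMap R F p ≠ 0 := by
    rwa [Ne, FaithfulSMul.algebraMap_eq_zero_iff]
  obtain ⟨Pi, hPic, -, hPPi, hPiP, hSPi, hPiS⟩ := h.P_inv hπ
  obtain ⟨n, hn0, hn⟩ := h.pw
  have hex : ∃ E : ℕ, ¬ fs (algebraMap R F p) S ≤ P ^ (E + 2) := by
    refine ⟨n, fun hle => h.one_not ?_⟩
    have h1 : P ^ (n + 2) ≤ fs (algebraMap R F p) P := by
      rw [pow_add]
      refine (mul_le_mul_left hn _).trans ?_
      rw [fs_mul]
      refine fs_mono _ ?_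
      rw [pow_two, ← mul_assoc, h.SPeq]
      exact (mul_le_mul_right h.P_le _).trans h.PS
    have h2 := fs_mono (algebraMap R F p)⁻¹ (hle.trans h1)
    rw [fs_inv_cancel hπ, fs_inv_cancel hπ] at h2
    exact h2 h.e_mem
  classical
  let E := Nat.find hex
  have hE2 : ¬ fs (algebraMap R F p) S ≤ P ^ (E + 2) := Nat.find_spec hex
  have hE1 : fs (algebraMap R F p) S ≤ P ^ (E + 1) := by
    rcases hE : E with _ | k
    · simpa using h.piS
    · have := Nat.find_min hex (m := k) (by change k < E; omega)
      simpa using this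
  refine ⟨E, ?_⟩
  have hcomm : Commute P Pi := by change P * Pi = Pi * P; rw [hPPi, hPiP]
  have hpp : ∀ k : ℕ, P ^ (k + 1) * Pi ^ (k + 1) = S := by
    intro k
    induction k with
    | zero => simpa using hPPi
    | succ k ih =>
      have : P ^ (k + 1 + 1) * Pi ^ (k + 1 + 1) = P ^ (k + 1) * (P * Pi) * Pi ^ (k + 1) := by
        rw [pow_succ P, pow_succ' Pi]; simp only [mul_assoc]
      rw [this, hPPi, mul_assoc, pow_succ' Pi, ← mul_assoc S, hSPi, ← pow_succ', ih]
  have hpp' : Pi ^ (E + 1) * P ^ (E + 1) = S := by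
    rw [← hpp E]; exact ((hcomm.pow_pow _ _).eq).symm
  have hSPk : S * Pi ^ (E + 1) = Pi ^ (E + 1) := by rw [pow_succ', ← mul_assoc, hSPi]
  have hPkS : Pi ^ (E + 1) * S = Pi ^ (E + 1) := by rw [pow_succ, mul_assoc, hPiS]
  have hSPE : S * P ^ (E + 1) = P ^ (E + 1) := by rw [pow_succ', ← mul_assoc, h.SPeq]
  set X := fs (algebraMap R F p) (Pi ^ (E + 1)) with hX
  have hXS : X ≤ S := by
    rw [hX, ← hSPk, ← fs_mul]
    exact (mul_le_mul_left hE1 _).trans (hpp E).le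
  have hSX : S * X = X := by rw [hX, mul_fs, hSPk]
  have hXS' : X * S = X := by rw [hX, fs_mul, hPkS]
  have hPX : P * X = X * P := by rw [hX, mul_fs, fs_mul, (hcomm.pow_right (E + 1)).eq]
  have hXP : X * P ^ (E + 1) = fs (algebraMap R F p) S := by rw [hX, fs_mul, hpp']
  rcases h.lemmaC hp hXS hSX.le hXS'.le hPX with h1 | h1
  · exfalso
    apply hE2
    rw [← hXP, pow_succ' P (E + 1)]
    exact mul_le_mul_left h1 _
  · have := h.eq_of_mem hXS hSX.le h1
    rw [← hXP, this, hSPE]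

end HOrd

namespace HOrd

variable {R F B : Type} [CommRing R] [IsDomain R] [IsDiscreteValuationRing R]
  [Field F] [Algebra R F] [IsFractionRing R F] [Ring B] [Algebra F B] [Algebra R B]
  [IsScalarTower R F B] {p : R} {e f : B} {S P S' Q : Submodule R B}

lemma corner_mul3 (e f g : B) : corner R e f * corner R f g ≤ corner R e g := by
  rw [Submodule.mul_le]
  rintro x ⟨h1, h2⟩ y ⟨h3, h4⟩
  exact ⟨by rw [← mul_assoc, h1], by rw [mul_assoc, h4]⟩

lemma exists_fg_left {π : F} (hπ : π ≠ 0) (hf : f ∈ corner R f e * corner R e f)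
    {L : Submodule R B} (hfull : ∀ x ∈ corner R e f, ∃ n : ℕ, π ^ n • x ∈ L) :
    ∃ H : Submodule R B, H.FG ∧ H ≤ corner R f e ∧ f ∈ H * L := by
  refine Submodule.mul_induction_on (C := fun x => ∃ H : Submodule R B, H.FG ∧ H ≤ corner R f e ∧
    x ∈ H * L) hf ?_ ?_
  · intro a ha b hb
    obtain ⟨n, hn⟩ := hfull b hb
    refine ⟨Submodule.span R {(π ^ n)⁻¹ • a}, Submodule.fg_span_singleton _, ?_, ?_⟩
    · rw [Submodule.span_singleton_le_iff_mem]
      exact ⟨by rw [mul_smul_comm, ha.1], by rw [smul_mul_assoc, ha.2]⟩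
    · have := Submodule.mul_mem_mul (Submodule.mem_span_singleton_self (R := R) ((π ^ n)⁻¹ • a)) hn
      rwa [smul_mul_assoc, mul_smul_comm, smul_smul, inv_mul_cancel₀ (pow_ne_zero _ hπ),
        one_smul] at this
  · rintro x y ⟨H, h1, h2, h3⟩ ⟨H', h1', h2', h3'⟩
    refine ⟨H ⊔ H', h1.sup h1', sup_le h2 h2', ?_⟩
    rw [Submodule.sup_mul]
    exact Submodule.add_mem_sup h3 h3'

lemma fs_mem_pow_of_fg {π : F} (hπ : π = algebraMap R F p) {S L : Submodule R B} (hL : L.FG)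
    (h : ∀ x ∈ L, ∃ n : ℕ, π ^ n • x ∈ S) : ∃ n : ℕ, fs (π ^ n) L ≤ S := by
  obtain ⟨t, rfl⟩ := hL
  choose! n hn using h
  have hmono : ∀ (x : B) (a b : ℕ), a ≤ b → π ^ a • x ∈ S → π ^ b • x ∈ S := by
    intro x a b hab hx
    obtain ⟨c, rfl⟩ := Nat.exists_eq_add_of_le hab
    rw [add_comm, pow_add, ← smul_smul, hπ, ← map_pow, algebraMap_smul, ← hπ]
    exact S.smul_mem _ hx
  refine ⟨t.sup n, ?_⟩
  rintro _ ⟨x, hx, rfl⟩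
  induction hx using Submodule.span_induction with
  | mem x hx =>
    exact hmono x (n x) _ (Finset.le_sup (f := n) hx) (hn x (Submodule.subset_span hx))
  | zero => simp
  | add x y _ _ hx hy => rw [smul_add]; exact add_mem hx hy
  | smul r x _ hx => rw [fcomm]; exact S.smul_mem _ hx

/-- Proposition A, first half. -/
theorem propA (hp : IsLocalRing.maximalIdeal R = Ideal.span {p}) (hp0 : p ≠ 0)
    (h : HOrd R (algebraMap R F p) e S P) (h' : HOrd R (algebraMap R F p) f S' Q)
    (hf : f ∈ corner R f e * corner R e f)
    {L : Submodule R B} (hLc : L ≤ corner R e f) (hSL : S * L ≤ L) (hLS : L * S' ≤ L)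
    (hfg : L.FG) (hfull : ∀ x ∈ corner R e f, ∃ n : ℕ, (algebraMap R F p) ^ n • x ∈ L)
    (hPL : P * L = L * Q) :
    ∃ M : Submodule R B, M ≤ corner R f e ∧ M.FG ∧ S' * M ≤ M ∧ M * S ≤ M ∧ L * M = S ∧
      f ∈ M * L ∧ Q * M = M * P ∧ (∀ x ∈ corner R f e, ∃ n : ℕ, (algebraMap R F p) ^ n • x ∈ M) := by
  have hπ : algebraMap R F p ≠ 0 := by
    rwa [Ne, FaithfulSMul.algebraMap_eq_zero_iff]
  obtain ⟨Pi, hPic, -, hPPi, hPiP, hSPi, hPiS⟩ := h.P_inv hπ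
  obtain ⟨Qi, hQic, -, hQQi, hQiQ, hSQi, hQiS⟩ := h'.P_inv hπ
  obtain ⟨M, hM⟩ : ∃ M, M = ldual S e f L := ⟨_, rfl⟩
  have hmM : ∀ w, w ∈ M ↔ w ∈ corner R f e ∧ ∀ l ∈ L, l * w ∈ S := fun w => by rw [hM]; rfl
  have hle : ∀ Y : Submodule R B, Y ≤ corner R f e → L * Y ≤ S → Y ≤ M := fun Y hY h1 w hw =>
    (hmM w).2 ⟨hY hw, fun l hl => h1 (Submodule.mul_mem_mul hl hw)⟩
  have hMc : M ≤ corner R f e := fun w hw => ((hmM w).1 hw).1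
  have hLM : L * M ≤ S := by
    rw [Submodule.mul_le]; intro l hl w hw; exact ((hmM w).1 hw).2 l hl
  have hfML : f ∈ M * L := hM ▸ h.hered f L h'.idem hf hLc hSL hfg hfull
  have hMfg : M.FG := by
    obtain ⟨H, hH1, hH2, hH3⟩ := exists_fg_left hπ hf hfull
    refine (hH1.mul h.fg).of_le ?_
    refine (le_mul_left' hH3 fun x hx => (hMc hx).1).trans ?_
    rw [mul_assoc]; exact mul_le_mul_right hLM _
  have hSM : S' * M ≤ M := by
    refine hle _ ((mul_le_mul' h'.S_le hMc).trans (corner_mul3 f f e)) ?_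
    rw [← mul_assoc]; exact (mul_le_mul_left hLS _).trans hLM
  have hMS : M * S ≤ M := by
    refine hle _ ((mul_le_mul' hMc h.S_le).trans (corner_mul3 f e e)) ?_
    rw [← mul_assoc]; exact (mul_le_mul_left hLM _).trans h.SS
  have hSLeq : S * L = L := le_antisymm hSL (le_mul_left' h.e_mem fun x hx => (hLc hx).1)
  have hLSeq : L * S' = L := le_antisymm hLS (le_mul_right' h'.e_mem fun x hx => (hLc hx).2)
  have hSMeq : S' * M = M := le_antisymm hSM (le_mul_left' h'.e_mem fun x hx => (hMc hx).1)
  have hMSeq : M * S = M := le_antisymm hMS (le_mul_right' h.e_mem fun x hx => (hMc hx).2)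
  have hPc := h.P_le.trans h.S_le
  have hQc := h'.P_le.trans h'.S_le
  have hQM1 : Q * M * Pi ≤ M := by
    refine hle _ ?_ ?_
    · exact (mul_le_mul' ((mul_le_mul' hQc hMc).trans (corner_mul3 f f e)) hPic).trans
        (corner_mul3 f e e)
    · have : L * (Q * M * Pi) = P * (L * M) * Pi := by
        rw [← mul_assoc, ← mul_assoc, ← hPL]; simp only [mul_assoc]
      rw [this]
      refine (mul_le_mul_left (mul_le_mul_right hLM _) _).trans ?_
      rw [h.PSeq, hPPi]
  have hLQi : L * Qi = Pi * L := by
    calc L * Qi = Pi * P * (L * Qi) := by rw [hPiP, ← mul_assoc, hSLeq]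
      _ = Pi * (P * L) * Qi := by simp only [mul_assoc]
      _ = Pi * L * (Q * Qi) := by rw [hPL]; simp only [mul_assoc]
      _ = Pi * L := by rw [hQQi, mul_assoc, hLSeq]
  have hQM2 : Qi * M * P ≤ M := by
    refine hle _ ?_ ?_
    · exact (mul_le_mul' ((mul_le_mul' hQic hMc).trans (corner_mul3 f f e)) hPc).trans
        (corner_mul3 f e e)
    · have : L * (Qi * M * P) = Pi * (L * M) * P := by
        rw [← mul_assoc, ← mul_assoc, hLQi]; simp only [mul_assoc]
      rw [this]
      refine (mul_le_mul_left (mul_le_mul_right hLM _) _).trans ?_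
      rw [hPiS, hPiP]
  have hQM : Q * M = M * P := by
    apply le_antisymm
    · calc Q * M = Q * M * Pi * P := by rw [mul_assoc (Q * M), hPiP, mul_assoc, hMSeq]
        _ ≤ M * P := mul_le_mul_left hQM1 _
    · calc M * P = Q * (Qi * M * P) := by
            rw [← mul_assoc, ← mul_assoc, hQQi, hSMeq]
        _ ≤ Q * M := mul_le_mul_right hQM2 _
  have hPT : P * (L * M) = L * M * P := by
    rw [← mul_assoc, hPL, mul_assoc, hQM, mul_assoc]
  have hST : S * (L * M) ≤ L * M := by rw [← mul_assoc, hSLeq]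
  have hTS : L * M * S ≤ L * M := by rw [mul_assoc, hMSeq]
  have hT : L * M = S := by
    rcases h.lemmaC hp hLM hST hTS hPT with h1 | h1
    · exfalso
      have h2 : L ≤ P * L :=
        (le_mul_right' hfML fun x hx => (hLc hx).2).trans (by
          rw [← mul_assoc]; exact mul_le_mul_left h1 _)
      have h3 : ∀ n : ℕ, L ≤ P ^ n * L := by
        intro n
        induction n with
        | zero => simp
        | succ n ih =>
          refine ih.trans ?_
          rw [pow_succ, mul_assoc]; exact mul_le_mul_right h2 _
      obtain ⟨n, hn0, hn⟩ := h.pw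
      have h4 : L ≤ fs (algebraMap R F p) L := by
        refine (h3 n).trans ((mul_le_mul_left hn _).trans ?_)
        rw [fs_mul, hSLeq]
      have h5 : L = ⊥ := by
        refine Submodule.eq_bot_of_le_smul_of_le_jacobson_bot (Ideal.span {p}) L hfg ?_ ?_
        · intro x hx
          obtain ⟨y, hy, rfl⟩ := h4 hx
          rw [algebraMap_smul]
          exact Submodule.smul_mem_smul (Ideal.mem_span_singleton_self p) hy
        · rw [IsLocalRing.jacobson_eq_maximalIdeal _ bot_ne_top, hp]
      rw [h5, Submodule.mul_bot] at hfML
      exact h'.e_ne ((Submodule.mem_bot R).1 hfML)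
    · exact h.eq_of_mem hLM hST h1
  refine ⟨M, hMc, hMfg, hSM, hMS, hT, hfML, hQM, ?_⟩
  intro w hw
  obtain ⟨n, hn⟩ := fs_mem_pow_of_fg (π := algebraMap R F p) rfl (S := S)
    (hfg.mul (Submodule.fg_span_singleton w)) (fun x hx => h.full x (by
      refine (mul_le_mul' hLc ?_).trans (corner_mul3 e f e) hx
      rw [Submodule.span_singleton_le_iff_mem]; exact hw))
  refine ⟨n, (hmM _).2 ⟨⟨?_, ?_⟩, fun l hl => ?_⟩⟩
  · rw [mul_smul_comm, hw.1]
  · rw [smul_mul_assoc, hw.2]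
  · rw [mul_smul_comm]
    exact hn (fs_mem (Submodule.mul_mem_mul hl (Submodule.mem_span_singleton_self w)))

/-- Proposition A. -/
theorem propA' (hp : IsLocalRing.maximalIdeal R = Ideal.span {p}) (hp0 : p ≠ 0)
    (h : HOrd R (algebraMap R F p) e S P) (h' : HOrd R (algebraMap R F p) f S' Q)
    (hf : f ∈ corner R f e * corner R e f)
    {L : Submodule R B} (hLc : L ≤ corner R e f) (hSL : S * L ≤ L) (hLS : L * S' ≤ L)
    (hfg : L.FG) (hfull : ∀ x ∈ corner R e f, ∃ n : ℕ, (algebraMap R F p) ^ n • x ∈ L)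
    (hPL : P * L = L * Q) :
    ∃ M : Submodule R B, M ≤ corner R f e ∧ M.FG ∧ S' * M ≤ M ∧ M * S ≤ M ∧ L * M = S ∧
      M * L = S' ∧ (∀ x ∈ corner R f e, ∃ n : ℕ, (algebraMap R F p) ^ n • x ∈ M) := by
  obtain ⟨M, hMc, hMfg, hSM, hMS, hLM, hfML, hQM, hMfull⟩ :=
    propA hp hp0 h h' hf hLc hSL hLS hfg hfull hPL
  refine ⟨M, hMc, hMfg, hSM, hMS, hLM, ?_, hMfull⟩
  obtain ⟨G, hG⟩ : ∃ G, G = M * L := ⟨_, rfl⟩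
  have hGc : G ≤ corner R f f := hG ▸ (mul_le_mul' hMc hLc).trans (corner_mul3 f e f)
  have hSG : S' * G ≤ G := by rw [hG, ← mul_assoc]; exact mul_le_mul_left hSM _
  have hGS : G * S' ≤ G := by rw [hG, mul_assoc]; exact mul_le_mul_right hLS _
  have hSleG : S' ≤ G :=
    (le_mul_right' (hG ▸ hfML) fun x hx => h'.mul_e hx).trans hSG
  have hGG : G * G ≤ G := by
    have : G * G = M * (L * M) * L := by rw [hG]; simp only [mul_assoc]
    rw [this, hLM, hG]; exact mul_le_mul_left hMS _
  have hQG : Q * G = G * Q := by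
    rw [hG, ← mul_assoc, hQM, mul_assoc, hPL, mul_assoc]
  obtain ⟨N, -, -, -, -, hGN, -, -⟩ := propA hp hp0 h' h' h'.e_self_corner hGc hSG hGS
    (hG ▸ hMfg.mul hfg) (fun x hx => (h'.full x hx).imp fun n hn => hSleG hn) hQG
  rw [← hG]
  refine le_antisymm ?_ hSleG
  calc G ≤ G * S' := le_mul_right' h'.e_mem fun x hx => (hGc hx).2
    _ = G * G * N := by rw [← hGN, mul_assoc]
    _ ≤ G * N := mul_le_mul_left hGG _
    _ = S' := hGN

/-- Local theorem. -/
theorem local_morita (hp : IsLocalRing.maximalIdeal R = Ideal.span {p}) (hp0 : p ≠ 0)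
    (h : HOrd R (algebraMap R F p) e S P) (h' : HOrd R (algebraMap R F p) f S' Q)
    (hf : f ∈ corner R f e * corner R e f)
    (E : ℕ) (hE : P ^ (E + 1) = fs (algebraMap R F p) S)
    (hE' : Q ^ (E + 1) = fs (algebraMap R F p) S')
    (L₀ : Submodule R B) (hL0c : L₀ ≤ corner R e f) (hL0fg : L₀.FG)
    (hL0full : ∀ x ∈ corner R e f, ∃ n : ℕ, (algebraMap R F p) ^ n • x ∈ L₀) :
    ∃ L M : Submodule R B, L ≤ corner R e f ∧ M ≤ corner R f e ∧ L.FG ∧ M.FG ∧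
      S * L ≤ L ∧ L * S' ≤ L ∧ S' * M ≤ M ∧ M * S ≤ M ∧ L * M = S ∧ M * L = S' ∧
      (∀ x ∈ corner R e f, ∃ n : ℕ, (algebraMap R F p) ^ n • x ∈ L) ∧
      (∀ x ∈ corner R f e, ∃ n : ℕ, (algebraMap R F p) ^ n • x ∈ M) := by
  have hπ : algebraMap R F p ≠ 0 := by
    rwa [Ne, FaithfulSMul.algebraMap_eq_zero_iff]
  obtain ⟨Pi, hPic, hPifg, hPPi, hPiP, hSPi, hPiS⟩ := h.P_inv hπ
  have hQfg : Q.FG := h'.fg.of_le h'.P_le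
  have hQc := h'.P_le.trans h'.S_le
  obtain ⟨L1, hL1⟩ : ∃ L1, L1 = S * L₀ * S' := ⟨_, rfl⟩
  have hL1c : L1 ≤ corner R e f := by
    rw [hL1]
    exact (mul_le_mul' ((mul_le_mul' h.S_le hL0c).trans (corner_mul3 e e f)) h'.S_le).trans
      (corner_mul3 e f f)
  have hSL1 : S * L1 = L1 := by rw [hL1, ← mul_assoc, ← mul_assoc, h.SSeq]
  have hL1S : L1 * S' = L1 := by rw [hL1, mul_assoc, h'.SSeq]
  have hL0L1 : L₀ ≤ L1 := by
    rw [hL1]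
    refine (le_mul_left' h.e_mem fun x hx => (hL0c hx).1).trans ?_
    refine le_mul_right' h'.e_mem fun x hx => ?_
    exact (((mul_le_mul' h.S_le hL0c).trans (corner_mul3 e e f)) hx).2
  have hL1fg : L1.FG := hL1 ▸ (h.fg.mul hL0fg).mul h'.fg
  let t : ℕ → Submodule R B := fun i => Pi ^ i * L1 * Q ^ i
  have ht0 : t 0 = L1 := by simp [t]
  have htsucc : ∀ i, t (i + 1) = Pi * t i * Q := fun i => by
    simp only [t]; rw [pow_succ', pow_succ]; simp only [mul_assoc]
  have htc : ∀ i, t i ≤ corner R e f := by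
    intro i
    induction i with
    | zero => rw [ht0]; exact hL1c
    | succ i ih =>
      rw [htsucc]
      exact (mul_le_mul' ((mul_le_mul' hPic ih).trans (corner_mul3 e e f)) hQc).trans
        (corner_mul3 e f f)
  have htfg : ∀ i, (t i).FG := by
    intro i
    induction i with
    | zero => rw [ht0]; exact hL1fg
    | succ i ih => rw [htsucc]; exact (hPifg.mul ih).mul hQfg
  have hSt : ∀ i, S * t i = t i := by
    intro i
    cases i with
    | zero => rw [ht0, hSL1]
    | succ i => rw [htsucc, ← mul_assoc, ← mul_assoc, hSPi]
  have htS : ∀ i, t i * S' = t i := by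
    intro i
    cases i with
    | zero => rw [ht0, hL1S]
    | succ i => rw [htsucc, mul_assoc, h'.PSeq]
  have hPiPow : ∀ k : ℕ, Pi ^ (k + 1) * P ^ (k + 1) = S := by
    intro k
    induction k with
    | zero => simpa using hPiP
    | succ k ih =>
      have : Pi ^ (k + 1 + 1) * P ^ (k + 1 + 1) = Pi ^ (k + 1) * (Pi * P) * P ^ (k + 1) := by
        rw [pow_succ Pi, pow_succ' P]; simp only [mul_assoc]
      rw [this, hPiP, mul_assoc, pow_succ' P, ← mul_assoc S, h.SPeq, ← pow_succ', ih]
  have htE : t (E + 1) = L1 := by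
    simp only [t]
    rw [hE', mul_fs, mul_assoc, hL1S, ← hSL1, ← mul_fs, ← fs_mul, ← hE, ← mul_assoc, hPiPow]
  obtain ⟨L, hL⟩ : ∃ L, L = ∑ i ∈ Finset.range (E + 1), t i := ⟨_, rfl⟩
  have hPiLQ : Pi * L * Q = L := by
    rw [hL, Finset.mul_sum, Finset.sum_mul]
    have : ∀ i ∈ Finset.range (E + 1), Pi * t i * Q = t (i + 1) := fun i _ => (htsucc i).symm
    rw [Finset.sum_congr rfl this, Finset.sum_range_succ, htE, Finset.sum_range_succ', ht0]
  have hSL : S * L = L := by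
    rw [hL, Finset.mul_sum]; exact Finset.sum_congr rfl fun i _ => hSt i
  have hLS : L * S' = L := by
    rw [hL, Finset.sum_mul]; exact Finset.sum_congr rfl fun i _ => htS i
  have hPL : P * L = L * Q := by
    conv_lhs => rw [← hPiLQ]
    rw [← mul_assoc, ← mul_assoc, hPPi, hSL]
  have hLc : L ≤ corner R e f := by
    rw [hL]
    refine Finset.sum_induction t (fun X => X ≤ corner R e f) (fun a b ha hb => sup_le ha hb)
      bot_le fun i _ => htc i
  have hLfg : L.FG := by
    rw [hL]
    exact Finset.sum_induction t (fun X => X.FG) (fun a b ha hb => ha.sup hb)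
      Submodule.fg_bot fun i _ => htfg i
  have hL1L : L1 ≤ L := by
    rw [hL, Finset.sum_range_succ', ht0]; exact le_sup_right
  have hLfull : ∀ x ∈ corner R e f, ∃ n : ℕ, (algebraMap R F p) ^ n • x ∈ L :=
    fun x hx => (hL0full x hx).imp fun n hn => hL1L (hL0L1 hn)
  obtain ⟨M, hMc, hMfg, hSM, hMS, hLM, hML, hMfull⟩ :=
    propA' hp hp0 h h' hf hLc hSL.le hLS.le hLfg hLfull hPL
  exact ⟨L, M, hLc, hMc, hLfg, hMfg, hSL.le, hLS.le, hSM, hMS, hLM, hML, hLfull, hMfull⟩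

end HOrd

section Hered

/-- every module embedding in `M` is projective -/
def SubProj (Λ M : Type) [Ring Λ] [AddCommGroup M] [Module Λ M] : Prop :=
  ∀ (N : Type) [AddCommGroup N] [Module Λ N] (g : N →ₗ[Λ] M), Function.Injective g →
    Module.Projective Λ N

variable {Λ : Type} [Ring Λ]

lemma SubProj.prod {M₁ M₂ : Type} [AddCommGroup M₁] [Module Λ M₁] [AddCommGroup M₂] [Module Λ M₂]
    (h1 : SubProj Λ M₁) (h2 : SubProj Λ M₂) : SubProj Λ (M₁ × M₂) := by
  intro N _ _ g hg
  let q : N →ₗ[Λ] M₂ := (LinearMap.snd Λ M₁ M₂).comp g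
  have hr : Module.Projective Λ (LinearMap.range q) :=
    h2 _ (LinearMap.range q).subtype Subtype.val_injective
  have hk : Module.Projective Λ (LinearMap.ker q) := by
    refine h1 _ ((LinearMap.fst Λ M₁ M₂).comp (g.comp (LinearMap.ker q).subtype)) ?_
    intro a b hab
    apply Subtype.ext
    apply hg
    refine Prod.ext hab ?_
    have ha : q a = 0 := a.2
    have hb : q b = 0 := b.2
    exact ha.trans hb.symm
  obtain ⟨σ, hσ⟩ := Module.projective_lifting_property q.rangeRestrict LinearMap.id
    q.surjective_rangeRestrict
  have hσ' : ∀ r, q (σ r) = r := fun r => congrArg Subtype.val (LinearMap.congr_fun hσ r)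
  let k : N →ₗ[Λ] LinearMap.ker q := LinearMap.codRestrict _ (LinearMap.id - σ.comp q.rangeRestrict)
    (fun n => by
      have := hσ' (q.rangeRestrict n)
      rw [LinearMap.mem_ker]
      change q (n - σ (q.rangeRestrict n)) = 0
      rw [map_sub, this]
      exact sub_self _)
  refine Module.Projective.of_split (k.prod q.rangeRestrict)
    ((LinearMap.ker q).subtype.coprod σ) ?_
  ext n
  simp [k]

lemma SubProj.of_inj {M₁ M₂ : Type} [AddCommGroup M₁] [Module Λ M₁] [AddCommGroup M₂] [Module Λ M₂]
    (h2 : SubProj Λ M₂) (g : M₁ →ₗ[Λ] M₂) (hg : Function.Injective g) : SubProj Λ M₁ :=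
  fun N _ _ g' hg' => h2 N (g.comp g') (hg.comp hg')

lemma SubProj.fin (h : SubProj Λ Λ) (n : ℕ) : SubProj Λ (Fin n → Λ) := by
  induction n with
  | zero =>
    intro N _ _ g hg
    have : Subsingleton N := hg.subsingleton
    infer_instance
  | succ n ih =>
    exact (h.prod ih).of_inj (Fin.consLinearEquiv Λ (fun _ => Λ)).symm.toLinearMap
      (LinearEquiv.injective _)

lemma SubProj.pi (h : SubProj Λ Λ) (ι : Type) [Fintype ι] : SubProj Λ (ι → Λ) :=
  (h.fin (Fintype.card ι)).of_inj
    (LinearEquiv.funCongrLeft Λ Λ (Fintype.equivFin ι).symm).toLinearMap (LinearEquiv.injective _)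

lemma subProj_of_ideals (h : ∀ I : Ideal Λ, Module.Projective Λ I) : SubProj Λ Λ := by
  intro N _ _ g hg
  have := h (LinearMap.range g)
  exact Module.Projective.of_equiv (LinearEquiv.ofInjective g hg).symm

end Hered

section Build

variable {R F B Λ : Type} [CommRing R] [IsDomain R] [IsDiscreteValuationRing R]
  [Field F] [Algebra R F] [IsFractionRing R F] [Ring B] [Algebra F B] [Algebra R B]
  [IsScalarTower R F B] {p : R} [Ring Λ] [Algebra R Λ] [Module.Finite R Λ]

lemma mul_mem_sum {X Y : Submodule R B} {x : B} (hx : x ∈ X * Y) :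
    ∃ (ι : Type) (_ : Fintype ι) (a b : ι → B), (∀ i, a i ∈ X) ∧ (∀ i, b i ∈ Y) ∧
      x = ∑ i, a i * b i := by
  refine Submodule.mul_induction_on hx ?_ ?_
  · intro a ha b hb
    exact ⟨Unit, inferInstance, fun _ => a, fun _ => b, fun _ => ha, fun _ => hb, by simp⟩
  · rintro x y ⟨ι, _, a, b, ha, hb, rfl⟩ ⟨ι', _, a', b', ha', hb', rfl⟩
    refine ⟨ι ⊕ ι', inferInstance, Sum.elim a a', Sum.elim b b', ?_, ?_, ?_⟩
    · rintro (i | i); exacts [ha i, ha' i]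
    · rintro (i | i); exacts [hb i, hb' i]
    · rw [Fintype.sum_sum_type]; simp

lemma build_hered (hp0 : p ≠ 0) (j : Λ →ₗ[R] B) (hjm : ∀ a b, j (a * b) = j a * j b)
    (hji : Function.Injective j) (hher : ∀ I : Ideal Λ, Module.Projective Λ I)
    (hfullS : ∀ x ∈ corner R (j 1) (j 1), ∃ n : ℕ, (algebraMap R F p) ^ n • x ∈ LinearMap.range j)
    (f : B) (L : Submodule R B) (_ : f * f = f)
    (hf : f ∈ corner R f (j 1) * corner R (j 1) f) (hLc : L ≤ corner R (j 1) f)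
    (hSL : LinearMap.range j * L ≤ L) (hfg : L.FG)
    (hfull : ∀ x ∈ corner R (j 1) f, ∃ n : ℕ, (algebraMap R F p) ^ n • x ∈ L) :
    f ∈ ldual (LinearMap.range j) (j 1) f L * L := by
  have hπ : algebraMap R F p ≠ 0 := by
    rwa [Ne, FaithfulSMul.algebraMap_eq_zero_iff]
  obtain ⟨H, hHfg, hHc, hfH⟩ := HOrd.exists_fg_left hπ hf hfull
  obtain ⟨k, hk⟩ := HOrd.fs_mem_pow_of_fg (π := algebraMap R F p) rfl (S := LinearMap.range j)
    (hfg.mul hHfg) (fun x hx => hfullS x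
      ((mul_le_mul' hLc hHc).trans (HOrd.corner_mul3 (j 1) f (j 1)) hx))
  obtain ⟨ι, _, h, b, hh, hb, hfs⟩ := mul_mem_sum hfH
  let inst : Module Λ L :=
    { smul := fun a l => ⟨j a * l, hSL (Submodule.mul_mem_mul ⟨a, rfl⟩ l.2)⟩
      one_smul := fun l => Subtype.ext (hLc l.2).1
      mul_smul := fun a c l => Subtype.ext (by
        change j (a * c) * (l : B) = j a * (j c * l)
        rw [hjm, mul_assoc])
      smul_zero := fun a => Subtype.ext (mul_zero _)
      smul_add := fun a x y => Subtype.ext (mul_add _ _ _)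
      add_smul := fun a c x => Subtype.ext (by
        change j (a + c) * (x : B) = j a * x + j c * x
        rw [map_add, add_mul])
      zero_smul := fun x => Subtype.ext (by
        change j 0 * (x : B) = 0
        rw [map_zero, zero_mul]) }
  have hsm : ∀ (a : Λ) (l : L), ((a • l : L) : B) = j a * l := fun a l => rfl
  have hρ : ∀ (l : L) (i : ι), ∃ a : Λ, j a = (algebraMap R F p) ^ k • ((l : B) * h i) :=
    fun l i => hk (fs_mem (Submodule.mul_mem_mul l.2 (hh i)))
  choose ρ0 hρ0 using hρ
  let ρ : L →ₗ[Λ] (ι → Λ) :=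
    { toFun := ρ0
      map_add' := fun x y => by
        ext i; apply hji
        rw [hρ0, Pi.add_apply, map_add, hρ0, hρ0, Submodule.coe_add, add_mul, smul_add]
      map_smul' := fun a x => by
        ext i; apply hji
        rw [hρ0, RingHom.id_apply, Pi.smul_apply, smul_eq_mul, hjm, hρ0, hsm, mul_assoc,
          mul_smul_comm] }
  have hsum : ∀ l : L, (l : B) = ∑ i, (l : B) * h i * b i := fun l => by
    conv_lhs => rw [← (hLc l.2).2, hfs, Finset.mul_sum]
    simp only [mul_assoc]
  have hρsum : ∀ l : L, (algebraMap R F p) ^ k • (l : B) = ∑ i, j (ρ0 l i) * b i := fun l => by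
    conv_lhs => rw [hsum l, Finset.smul_sum]
    refine Finset.sum_congr rfl fun i _ => ?_
    rw [hρ0, smul_mul_assoc]
  have hρi : Function.Injective ρ := by
    intro x y hxy
    have hxy' : ρ0 x = ρ0 y := hxy
    apply Subtype.ext
    have h1 := hρsum x
    rw [hxy', ← hρsum y] at h1
    have h2 := congrArg (fun z => ((algebraMap R F p) ^ k)⁻¹ • z) h1
    simpa [smul_smul, inv_mul_cancel₀ (pow_ne_zero k hπ)] using h2
  have hproj : Module.Projective Λ L := (subProj_of_ideals hher).pi ι L ρ hρi
  obtain ⟨s, hs⟩ := hproj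
  let fx : L → (L →ₗ[Λ] Λ) := fun x => (Finsupp.lapply x).comp s
  have hpk : ∀ l : L, (((p ^ k • (1 : Λ)) • l : L) : B) = (algebraMap R F p) ^ k • (l : B) := by
    intro l
    rw [hsm, map_smul, smul_mul_assoc, (hLc l.2).1, ← map_pow, algebraMap_smul]
  let w : L → B := fun x => ∑ i, h i * j (fx x ⟨b i, hb i⟩)
  have hlw : ∀ (x l : L), (l : B) * w x = j (fx x l) := by
    intro x l
    have h1 : (algebraMap R F p) ^ k • ((l : B) * w x) = (algebraMap R F p) ^ k • j (fx x l) := by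
      have e1 : (algebraMap R F p) ^ k • ((l : B) * w x) =
          ∑ i, j (ρ0 l i) * j (fx x ⟨b i, hb i⟩) := by
        simp only [w]
        rw [Finset.mul_sum, Finset.smul_sum]
        refine Finset.sum_congr rfl fun i _ => ?_
        rw [hρ0, smul_mul_assoc, mul_assoc]
      have e2 : (p ^ k • (1 : Λ)) • l = ∑ i, ρ0 l i • (⟨b i, hb i⟩ : L) := by
        apply Subtype.ext
        rw [hpk, hρsum, Submodule.coe_sum]
        rfl
      have e3 : j (fx x ((p ^ k • (1 : Λ)) • l)) = ∑ i, j (ρ0 l i) * j (fx x ⟨b i, hb i⟩) := by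
        rw [e2, map_sum, map_sum]
        refine Finset.sum_congr rfl fun i _ => ?_
        rw [map_smul, smul_eq_mul, hjm]
      rw [e1, ← e3, map_smul, smul_eq_mul, smul_mul_assoc, one_mul, map_smul, ← map_pow,
        algebraMap_smul]
    have h2 := congrArg (fun z => ((algebraMap R F p) ^ k)⁻¹ • z) h1
    simpa [smul_smul, inv_mul_cancel₀ (pow_ne_zero k hπ)] using h2
  have hwd : ∀ x, w x ∈ ldual (LinearMap.range j) (j 1) f L := by
    intro x
    refine ⟨Submodule.sum_mem _ fun i _ => ?_, fun l hl => ⟨_, (hlw x ⟨l, hl⟩).symm⟩⟩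
    refine ⟨?_, ?_⟩
    · rw [← mul_assoc, (hHc (hh i)).1]
    · rw [mul_assoc, ← hjm, mul_one]
  classical
  let T : Finset L := Finset.univ.biUnion fun i => (s ⟨b i, hb i⟩).support
  have hbi : ∀ i, b i = ∑ x ∈ T, j (fx x ⟨b i, hb i⟩) * (x : B) := by
    intro i
    have h1 := hs ⟨b i, hb i⟩
    rw [Finsupp.linearCombination_apply, Finsupp.sum_of_support_subset (s := T)] at h1
    · have h2 := congrArg (fun z : L => (z : B)) h1
      simp only [id] at h2
      rw [Submodule.coe_sum] at h2
      exact h2.symm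
    · exact Finset.subset_biUnion_of_mem (fun i => (s ⟨b i, hb i⟩).support) (Finset.mem_univ i)
    · intro x _; exact zero_smul _ _
  have : f = ∑ x ∈ T, w x * (x : B) := by
    rw [hfs]
    simp only [w]
    simp_rw [Finset.sum_mul]
    rw [Finset.sum_comm]
    refine Finset.sum_congr rfl fun i _ => ?_
    conv_lhs => rw [hbi i, Finset.mul_sum]
    simp only [mul_assoc]
  have h3 : ∑ x ∈ T, w x * (x : B) ∈ ldual (LinearMap.range j) (j 1) f L * L :=
    Submodule.sum_mem _ fun x _ => Submodule.mul_mem_mul (hwd x) x.2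
  rwa [← this] at h3

theorem build_HOrd [Nontrivial Λ] (hp : IsLocalRing.maximalIdeal R = Ideal.span {p}) (hp0 : p ≠ 0)
    (j : Λ →ₗ[R] B) (hjm : ∀ a b, j (a * b) = j a * j b)
    (hji : Function.Injective j) (hher : ∀ I : Ideal Λ, Module.Projective Λ I)
    (hfullS : ∀ x ∈ corner R (j 1) (j 1), ∃ n : ℕ, (algebraMap R F p) ^ n • x ∈ LinearMap.range j)
    (hcen : ∀ z ∈ corner R (j 1) (j 1), (∀ s ∈ LinearMap.range j, z * s = s * z) →
      ∃ a : F, z = a • j 1) :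
    HOrd R (algebraMap R F p) (j 1) (LinearMap.range j)
      (Submodule.map j ((Ring.jacobson Λ).restrictScalars R)) where
  idem := by rw [← hjm, mul_one]
  e_mem := ⟨1, rfl⟩
  S_le := by
    rintro _ ⟨a, rfl⟩
    exact ⟨by rw [← hjm, one_mul], by rw [← hjm, mul_one]⟩
  SS := by
    rw [Submodule.mul_le]
    rintro _ ⟨a, rfl⟩ _ ⟨b, rfl⟩
    exact ⟨a * b, hjm a b⟩
  P_le := LinearMap.map_le_range
  SP := by
    rw [Submodule.mul_le]
    rintro _ ⟨a, rfl⟩ _ ⟨b, hb, rfl⟩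
    exact ⟨a * b, Ideal.mul_mem_left _ a hb, hjm a b⟩
  PS := by
    rw [Submodule.mul_le]
    rintro _ ⟨b, hb, rfl⟩ _ ⟨a, rfl⟩
    exact ⟨b * a, Ideal.mul_mem_right a (Ring.jacobson Λ) hb, hjm b a⟩
  nak := by
    intro X hX hSX h1
    let Y : Ideal Λ :=
      { carrier := {a | j a ∈ X}
        zero_mem' := by simp
        add_mem' := by
          intro a b ha hb
          change j (a + b) ∈ X
          rw [map_add]; exact add_mem ha hb
        smul_mem' := by
          intro c a ha
          change j (c * a) ∈ X
          rw [hjm]; exact hSX (Submodule.mul_mem_mul ⟨c, rfl⟩ ha) }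
    obtain ⟨x, hx, _, ⟨b, hb, rfl⟩, hxb⟩ := Submodule.mem_sup.1 h1
    obtain ⟨a, rfl⟩ := hX hx
    rw [← map_add] at hxb
    exact jac_nakayama Y a b hx hb (hji hxb)
  piS := by
    rintro _ ⟨_, ⟨a, rfl⟩, rfl⟩
    refine ⟨p • a, ?_, by rw [map_smul, algebraMap_smul]⟩
    rw [Algebra.smul_def]
    exact Ideal.mul_mem_right a (Ring.jacobson Λ)
      (jac_mem_of_max p (by rw [hp]; exact Ideal.mem_span_singleton_self p))
  pw := by
    obtain ⟨n, hn0, hn⟩ := jac_pow_le (Λ := Λ) p hp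
    refine ⟨n, hn0, ?_⟩
    have key : ∀ k : ℕ, (Submodule.map j ((Ring.jacobson Λ).restrictScalars R)) ^ (k + 1) ≤
        Submodule.map j (((Ring.jacobson Λ) ^ (k + 1)).restrictScalars R) := by
      intro k
      induction k with
      | zero => rw [zero_add, pow_one, Submodule.pow_one]
      | succ k ih =>
        rw [pow_succ, Submodule.mul_le]
        rintro x hx _ ⟨b, hb, rfl⟩
        obtain ⟨a, ha, rfl⟩ := ih hx
        refine ⟨a * b, ?_, hjm a b⟩
        change a * b ∈ (Ring.jacobson Λ) ^ (k + 1 + 1)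
        rw [Submodule.pow_succ]
        exact Ideal.mul_mem_mul ha hb
    obtain ⟨k, rfl⟩ : ∃ k, n = k + 1 := ⟨n - 1, by omega⟩
    intro x hx
    obtain ⟨a, ha, rfl⟩ := key k hx
    obtain ⟨y, rfl⟩ := hn a ha
    exact ⟨j y, ⟨y, rfl⟩, by rw [map_smul, algebraMap_smul]⟩
  lid := by
    intro X hX hSX hXS
    let Y : Ideal Λ :=
      { carrier := {a | j a ∈ X}
        zero_mem' := by simp
        add_mem' := by
          intro a b ha hb
          change j (a + b) ∈ X
          rw [map_add]; exact add_mem ha hb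
        smul_mem' := by
          intro c a ha
          change j (c * a) ∈ X
          rw [hjm]; exact hSX (Submodule.mul_mem_mul ⟨c, rfl⟩ ha) }
    have : Y.IsTwoSided := ⟨fun {a} b ha => by
      change j _ ∈ X
      rw [hjm]; exact hXS (Submodule.mul_mem_mul ha ⟨b, rfl⟩)⟩
    obtain ⟨c, hc, hcx⟩ := jac_left_identity p hp Y
    refine ⟨j c, hc, fun x hx => ?_⟩
    obtain ⟨a, rfl⟩ := hX hx
    refine ⟨(1 - c) * a, hcx a hx, ?_⟩
    rw [sub_mul, one_mul, map_sub, hjm]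
  one_not := by
    rintro ⟨a, ha, h1⟩
    rw [hji h1] at ha
    have : (1 : Λ) ∈ (⊥ : Ideal Λ) := jac_nakayama ⊥ 0 1 (zero_mem _) ha (zero_add _)
    exact one_ne_zero ((Submodule.mem_bot Λ).1 this)
  full := hfullS
  fg := by
    rw [LinearMap.range_eq_map]; exact Module.Finite.fg_top.map j
  hered := build_hered hp0 j hjm hji hher hfullS
  central := hcen

end Build

namespace AlgCurve

variable {k : Type} [Field k] (C : AlgCurve k)

lemma mem_O {x : C.Point} {f : C.F} : f ∈ C.O x ↔ f = 0 ∨ 0 ≤ C.ord x f := Iff.rfl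

lemma ord_inv (x : C.Point) (f : C.F) (hf : f ≠ 0) : C.ord x f⁻¹ = - C.ord x f := by
  have h := C.ord_mul x f f⁻¹ hf (inv_ne_zero hf)
  rw [mul_inv_cancel₀ hf, C.ord_one] at h; omega

lemma ord_pow (x : C.Point) (f : C.F) (hf : f ≠ 0) (n : ℕ) : C.ord x (f ^ n) = n * C.ord x f := by
  induction n with
  | zero => simp [C.ord_one]
  | succ n ih => rw [pow_succ, C.ord_mul x _ _ (pow_ne_zero _ hf) hf, ih]; push_cast; ring

lemma isUnit_iff {x : C.Point} (r : C.O x) (hr : r ≠ 0) : IsUnit r ↔ C.ord x r = 0 := by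
  have hr' : (r : C.F) ≠ 0 := fun h => hr (Subtype.ext h)
  constructor
  · rintro ⟨u, rfl⟩
    have h1 : ((u : C.O x) : C.F) * ((u⁻¹ : (C.O x)ˣ) : C.O x) = 1 := by
      rw [← Subring.coe_mul, Units.mul_inv, Subring.coe_one]
    have h2 : (((u⁻¹ : (C.O x)ˣ) : C.O x) : C.F) ≠ 0 := right_ne_zero_of_mul_eq_one h1
    have h3 := C.ord_mul x _ _ hr' h2
    rw [h1, C.ord_one] at h3
    have h4 := (C.mem_O.1 (u : C.O x).2).resolve_left hr'
    have h5 := (C.mem_O.1 ((u⁻¹ : (C.O x)ˣ) : C.O x).2).resolve_left h2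
    omega
  · intro h
    have hi : (r : C.F)⁻¹ ∈ C.O x := Or.inr (by rw [C.ord_inv x _ hr', h]; simp)
    exact IsUnit.of_mul_eq_one ⟨_, hi⟩ (Subtype.ext (mul_inv_cancel₀ hr'))

/-- A chosen uniformizer. -/
lemma exists_unif (x : C.Point) : ∃ p : C.O x, p ≠ 0 ∧ C.ord x p = 1 := by
  obtain ⟨f, hf, h1⟩ := C.ord_exists_uniformizer x
  refine ⟨⟨f, Or.inr (by omega)⟩, fun h => hf (congrArg Subtype.val h), h1⟩

lemma assoc_of_ord_eq {x : C.Point} (r s : C.O x) (hr : r ≠ 0) (hs : s ≠ 0)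
    (h : C.ord x r = C.ord x s) : Associated r s := by
  have hr' : (r : C.F) ≠ 0 := fun h => hr (Subtype.ext h)
  have hs' : (s : C.F) ≠ 0 := fun h => hs (Subtype.ext h)
  have h0 : C.ord x ((r : C.F)⁻¹ * s) = 0 := by
    rw [C.ord_mul x _ _ (inv_ne_zero hr') hs', C.ord_inv x _ hr', h]; omega
  have hu : IsUnit (⟨(r : C.F)⁻¹ * s, Or.inr h0.ge⟩ : C.O x) := by
    rw [C.isUnit_iff]
    · exact h0
    · intro h; exact mul_ne_zero (inv_ne_zero hr') hs' (congrArg Subtype.val h)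
  obtain ⟨u, hu⟩ := hu
  refine ⟨u, ?_⟩
  rw [hu]
  exact Subtype.ext (by simp [mul_inv_cancel_left₀ hr'])

lemma unif_irreducible {x : C.Point} (p : C.O x) (hp0 : p ≠ 0) (hp : C.ord x p = 1) :
    Irreducible p := by
  refine ⟨fun h => ?_, ?_⟩
  · rw [C.isUnit_iff p hp0] at h; omega
  · intro a b hab
    have ha : a ≠ 0 := fun h => hp0 (by rw [hab, h, zero_mul])
    have hb : b ≠ 0 := fun h => hp0 (by rw [hab, h, mul_zero])
    have ha' : (a : C.F) ≠ 0 := fun h => ha (Subtype.ext h)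
    have hb' : (b : C.F) ≠ 0 := fun h => hb (Subtype.ext h)
    rw [C.isUnit_iff a ha, C.isUnit_iff b hb]
    have h := C.ord_mul x a b ha' hb'
    rw [← Subring.coe_mul, ← hab, hp] at h
    have h4 := (C.mem_O.1 a.2).resolve_left ha'
    have h5 := (C.mem_O.1 b.2).resolve_left hb'
    omega

instance (x : C.Point) : IsDiscreteValuationRing (C.O x) := by
  refine IsDiscreteValuationRing.ofHasUnitMulPowIrreducibleFactorization ?_
  obtain ⟨p, hp0, hp⟩ := C.exists_unif x
  have hp0' : (p : C.F) ≠ 0 := fun h => hp0 (Subtype.ext h)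
  refine ⟨p, C.unif_irreducible p hp0 hp, fun {r} hr => ?_⟩
  have hr' : (r : C.F) ≠ 0 := fun h => hr (Subtype.ext h)
  have h4 := (C.mem_O.1 r.2).resolve_left hr'
  refine ⟨(C.ord x r).toNat, C.assoc_of_ord_eq _ _ (pow_ne_zero _ hp0) hr ?_⟩
  rw [Subring.coe_pow, C.ord_pow x _ hp0', hp]
  omega

lemma exists_pow_mul_mem {x : C.Point} (p : C.O x) (hp0 : p ≠ 0) (hp : C.ord x p = 1) (a : C.F) :
    ∃ n : ℕ, (p : C.F) ^ n * a ∈ C.O x := by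
  by_cases ha : a = 0
  · exact ⟨0, Or.inl (by simp [ha])⟩
  have hp0' : (p : C.F) ≠ 0 := fun h => hp0 (Subtype.ext h)
  refine ⟨(- C.ord x a).toNat, Or.inr ?_⟩
  rw [C.ord_mul x _ _ (pow_ne_zero _ hp0') ha, C.ord_pow x _ hp0', hp]
  omega

instance (x : C.Point) : IsFractionRing (C.O x) C.F := by
  refine IsFractionRing.of_field _ _ fun z => ?_
  obtain ⟨p, hp0, hp⟩ := C.exists_unif x
  have hp0' : (p : C.F) ≠ 0 := fun h => hp0 (Subtype.ext h)
  obtain ⟨n, hn⟩ := C.exists_pow_mul_mem p hp0 hp z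
  refine ⟨⟨_, hn⟩, p ^ n, ?_⟩
  change z = ((p : C.F) ^ n * z) / ((p ^ n : C.O x) : C.F)
  rw [Subring.coe_pow, mul_div_cancel_left₀ _ (pow_ne_zero _ hp0')]

lemma maximalIdeal_eq {x : C.Point} (p : C.O x) (hp0 : p ≠ 0) (hp : C.ord x p = 1) :
    IsLocalRing.maximalIdeal (C.O x) = Ideal.span {p} :=
  (C.unif_irreducible p hp0 hp).maximalIdeal_eq

variable {V : Type} [AddCommGroup V] [Module C.F V]

lemma full_of_span {x : C.Point} (p : C.O x) (hp0 : p ≠ 0) (hp : C.ord x p = 1)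
    (L : Submodule (C.O x) V) (v : V) (hv : v ∈ Submodule.span C.F (L : Set V)) :
    ∃ n : ℕ, (algebraMap (C.O x) C.F p) ^ n • v ∈ L := by
  have hmono : ∀ (x : V) (a b : ℕ), a ≤ b → (p : C.F) ^ a • x ∈ L → (p : C.F) ^ b • x ∈ L := by
    intro y a b hab hy
    obtain ⟨c, rfl⟩ := Nat.exists_eq_add_of_le hab
    rw [add_comm, pow_add, ← smul_smul]
    exact L.smul_mem (p ^ c) hy
  change ∃ n : ℕ, (p : C.F) ^ n • v ∈ L
  induction hv using Submodule.span_induction with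
  | mem v hv => exact ⟨0, by simpa using hv⟩
  | zero => exact ⟨0, by simp⟩
  | add v w _ _ hv hw =>
    obtain ⟨n, hn⟩ := hv
    obtain ⟨m, hm⟩ := hw
    refine ⟨max n m, ?_⟩
    rw [smul_add]
    exact add_mem (hmono _ _ _ (le_max_left _ _) hn) (hmono _ _ _ (le_max_right _ _) hm)
  | smul a v _ hv =>
    obtain ⟨n, hn⟩ := hv
    obtain ⟨m, hm⟩ := C.exists_pow_mul_mem p hp0 hp a
    refine ⟨m + n, ?_⟩
    have : (p : C.F) ^ (m + n) • a • v = ((p : C.F) ^ m * a) • ((p : C.F) ^ n • v) := by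
      rw [smul_smul, smul_smul, pow_add]; congr 1; ring
    rw [this]
    exact L.smul_mem ⟨_, hm⟩ hn

lemma span_of_full {x : C.Point} (p : C.O x) (hp0 : p ≠ 0)
    (L : Submodule (C.O x) V) (h : ∀ v : V, ∃ n : ℕ, (algebraMap (C.O x) C.F p) ^ n • v ∈ L) :
    Submodule.span C.F (L : Set V) = ⊤ := by
  have hp0' : (p : C.F) ≠ 0 := fun h => hp0 (Subtype.ext h)
  rw [eq_top_iff]
  intro v _
  obtain ⟨n, hn⟩ := h v
  have := Submodule.smul_mem _ ((p : C.F) ^ n)⁻¹ (Submodule.subset_span (R := C.F) hn)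
  change ((p : C.F) ^ n)⁻¹ • (p : C.F) ^ n • v ∈ _ at this
  rwa [smul_smul, inv_mul_cancel₀ (pow_ne_zero _ hp0'), one_smul] at this

lemma finite_not_mem (f : C.F) : {x | f ∉ C.O x}.Finite := by
  by_cases hf : f = 0
  · refine Set.finite_empty.subset fun x hx => hx (Or.inl hf)
  · refine (C.ord_support_finite f hf).subset fun x hx h => hx (Or.inr h.ge)

lemma finite_span_not_le {ι κ : Type} [Finite ι] [Finite κ] (g : ι → V) (h : κ → V)
    (hgh : ∀ i, g i ∈ Submodule.span C.F (Set.range h)) :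
    {x | ¬ Submodule.span (C.O x) (Set.range g) ≤ Submodule.span (C.O x) (Set.range h)}.Finite := by
  have := Fintype.ofFinite κ
  simp_rw [Submodule.mem_span_range_iff_exists_fun] at hgh
  choose c hc using hgh
  have hfin : (⋃ i, ⋃ j, {x | c i j ∉ C.O x}).Finite :=
    Set.finite_iUnion fun i => Set.finite_iUnion fun j => C.finite_not_mem _
  refine hfin.subset fun x hx => ?_
  by_contra hcon
  simp only [Set.mem_iUnion, Set.mem_setOf_eq, not_exists, not_not] at hcon
  apply hx
  rw [Submodule.span_le]
  rintro _ ⟨i, rfl⟩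
  rw [← hc i]
  refine Submodule.sum_mem _ fun j _ => ?_
  exact Submodule.smul_mem _ (⟨c i j, hcon i j⟩ : C.O x) (Submodule.subset_span ⟨j, rfl⟩)

lemma finite_span_ne {ι κ : Type} [Finite ι] [Finite κ] (g : ι → V) (h : κ → V)
    (hg : Submodule.span C.F (Set.range g) = ⊤) (hh : Submodule.span C.F (Set.range h) = ⊤) :
    {x | Submodule.span (C.O x) (Set.range g) ≠ Submodule.span (C.O x) (Set.range h)}.Finite := by
  refine ((C.finite_span_not_le g h (by simp [hh])).union
    (C.finite_span_not_le h g (by simp [hg]))).subset fun x hx => ?_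
  by_contra hcon
  simp only [Set.mem_union, Set.mem_setOf_eq, not_or, not_not] at hcon
  exact hx (le_antisymm hcon.1 hcon.2)

end AlgCurve

section OrdFacts

variable {k : Type} [Field k] {C : AlgCurve k}
  {A : Type} [Ring A] [Algebra C.F A] [Algebra.IsCentral C.F A] [Nontrivial A]
  {B : Type} [Ring B] [Algebra C.F B]

lemma SheafOrder.central_of_comm (D : SheafOrder C A) (x : C.Point) (z : A)
    (hz : ∀ s ∈ D.Λ x, z * s = s * z) : ∃ a : C.F, z = a • (1 : A) := by
  have hz' : ∀ s : A, z * s = s * z := by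
    intro s
    have hs : s ∈ Submodule.span C.F ((D.Λ x).toSubmodule : Set A) := by
      rw [D.lattice.2.1 x]; trivial
    induction hs using Submodule.span_induction with
    | mem y hy => exact hz y hy
    | zero => simp
    | add a b _ _ ha hb => rw [mul_add, add_mul, ha, hb]
    | smul r a _ ha => rw [mul_smul_comm, smul_mul_assoc, ha]
  have : z ∈ Subalgebra.center C.F A := Subalgebra.mem_center_iff.2 fun b => (hz' b).symm
  have h2 := Algebra.IsCentral.out this
  obtain ⟨a, rfl⟩ := Algebra.mem_bot.1 h2
  exact ⟨a, by rw [Algebra.algebraMap_eq_smul_one]⟩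

lemma SheafOrder.hOrd (D : SheafOrder C A) (hD : D.IsHereditary) {x : C.Point} (p : C.O x)
    (hp0 : p ≠ 0) (hp : C.ord x p = 1) (j : A →ₗ[C.F] B)
    (hjm : ∀ a b, j (a * b) = j a * j b) (hji : Function.Injective j)
    (hr : ∀ y, j 1 * y = y → y * j 1 = y → ∃ a, j a = y) :
    HOrd (C.O x) (algebraMap (C.O x) C.F p) (j 1)
      ((D.Λ x).toSubmodule.map (j.restrictScalars (C.O x)))
      ((radSubG (C.O x) A (D.Λ x)).map (j.restrictScalars (C.O x))) := by
  have hfin : Module.Finite (C.O x) (D.Λ x) := D.lattice.1 x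
  let j' : D.Λ x →ₗ[C.O x] B := (j.restrictScalars (C.O x)) ∘ₗ (D.Λ x).val.toLinearMap
  have hj1 : j' 1 = j 1 := rfl
  have hrange : LinearMap.range j' = (D.Λ x).toSubmodule.map (j.restrictScalars (C.O x)) := by
    ext y; constructor
    · rintro ⟨a, rfl⟩; exact ⟨a, a.2, rfl⟩
    · rintro ⟨a, ha, rfl⟩; exact ⟨⟨a, ha⟩, rfl⟩
  have hrad : Submodule.map j' ((Ring.jacobson (D.Λ x)).restrictScalars (C.O x)) =
      (radSubG (C.O x) A (D.Λ x)).map (j.restrictScalars (C.O x)) := by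
    rw [radSubG, leftJacobson, Ideal.jacobson_bot, ← Submodule.map_comp]
  rw [← hrange, ← hrad, ← hj1]
  refine build_HOrd (C.maximalIdeal_eq p hp0 hp) hp0 j' ?_ ?_ (hD x) ?_ ?_
  · intro a b; exact hjm a b
  · intro a b hab; exact Subtype.ext (hji hab)
  · rintro y ⟨h1, h2⟩
    obtain ⟨a, rfl⟩ := hr y h1 h2
    obtain ⟨n, hn⟩ := C.full_of_span p hp0 hp (D.Λ x).toSubmodule a (by
      rw [D.lattice.2.1 x]; trivial)
    refine ⟨n, ⟨⟨_, hn⟩, ?_⟩⟩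
    change j _ = _
    rw [← map_smul]
    rfl
  · rintro z ⟨h1, h2⟩ hc
    obtain ⟨z, rfl⟩ := hr z h1 h2
    obtain ⟨a, ha⟩ := D.central_of_comm x z (fun s hs => hji (by
      rw [hjm, hjm]; exact hc _ ⟨⟨s, hs⟩, rfl⟩))
    exact ⟨a, by rw [hj1, ← map_smul, ha]⟩

lemma SheafOrder.hOrd_self (D : SheafOrder C A) (hD : D.IsHereditary) {x : C.Point} (p : C.O x)
    (hp0 : p ≠ 0) (hp : C.ord x p = 1) :
    HOrd (C.O x) (algebraMap (C.O x) C.F p) (1 : A)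
      (D.Λ x).toSubmodule (radSubG (C.O x) A (D.Λ x)) := by
  have := D.hOrd hD p hp0 hp LinearMap.id (fun _ _ => rfl) (fun _ _ h => h) (fun y _ _ => ⟨y, rfl⟩)
  have e : (LinearMap.id : A →ₗ[C.F] A).restrictScalars (C.O x) = LinearMap.id := rfl
  rwa [e, Submodule.map_id, Submodule.map_id] at this

lemma smul_eq_fs {x : C.Point} (q : C.O x) (X : Submodule (C.O x) A) :
    q • X = fs (algebraMap (C.O x) C.F q) X := by
  ext y
  rw [mem_fs, Submodule.mem_smul_pointwise_iff_exists]
  constructor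
  · rintro ⟨b, hb, rfl⟩; exact ⟨b, hb, (algebraMap_smul C.F q b).symm⟩
  · rintro ⟨b, hb, rfl⟩; exact ⟨b, hb, (algebraMap_smul C.F q b).symm⟩

lemma SheafOrder.hasIndexAt_iff (D : SheafOrder C A) (hD : D.IsHereditary) {x : C.Point} (p : C.O x)
    (hp0 : p ≠ 0) (hp : C.ord x p = 1) (e : ℕ) :
    D.HasIndexAt x e ↔ 0 < e ∧ radSubG (C.O x) A (D.Λ x) ^ e =
      fs (algebraMap (C.O x) C.F p) (D.Λ x).toSubmodule := by
  have h := D.hOrd_self hD p hp0 hp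
  have hpF : algebraMap (C.O x) C.F p ≠ 0 := by
    rwa [Ne, FaithfulSMul.algebraMap_eq_zero_iff]
  constructor
  · rintro ⟨q, hq, he⟩
    have hp1 : ∀ e : ℕ, algebraMap (C.O x) C.F p ^ e • (1 : A) ∈
        radSubG (C.O x) A (D.Λ x) ^ e := by
      intro e
      induction e with
      | zero => simp only [pow_zero, one_smul]; exact Submodule.one_le.1 le_rfl
      | succ n ih =>
        rw [pow_succ, pow_succ]
        have := Submodule.mul_mem_mul ih (h.piS (fs_mem h.e_mem))
        rwa [smul_mul_smul_comm, one_mul] at this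
    have hq0 : q ≠ 0 := by
      rintro rfl
      have h1 := hp1 e
      rw [he, smul_eq_fs] at h1
      obtain ⟨y, -, hy⟩ := h1
      rw [map_zero, zero_smul] at hy
      exact (smul_ne_zero (pow_ne_zero _ hpF) one_ne_zero) hy
    have hqs : q • (D.Λ x).toSubmodule =
        fs (algebraMap (C.O x) C.F p) (D.Λ x).toSubmodule := by
      obtain ⟨u, rfl⟩ := C.assoc_of_ord_eq p q hp0 hq0 (hp.trans hq.symm)
      rw [← smul_eq_fs, mul_smul]
      congr 1
      apply le_antisymm
      · rintro _ ⟨y, hy, rfl⟩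
        exact Submodule.smul_mem _ _ hy
      · intro y hy
        rw [Submodule.mem_smul_pointwise_iff_exists]
        exact ⟨(↑u⁻¹ : C.O x) • y, Submodule.smul_mem _ _ hy, by rw [smul_smul]; simp⟩
    rw [hqs] at he
    refine ⟨?_, he⟩
    rcases Nat.eq_zero_or_pos e with rfl | h0
    · exfalso
      rw [pow_zero] at he
      have : (1 : A) ∈ (1 : Submodule (C.O x) A) := Submodule.one_le.1 le_rfl
      rw [he] at this
      exact h.one_not (h.piS this)
    · exact h0
  · rintro ⟨-, he⟩
    exact ⟨p, hp, by rw [he, smul_eq_fs]⟩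

end OrdFacts

section GoodPoints

variable {k : Type} [Field k] (C : AlgCurve k)

lemma AlgCurve.finite_set_span_ne {V : Type} [AddCommGroup V] [Module C.F V] {s t : Set V}
    (hs : s.Finite) (ht : t.Finite) (hst : Submodule.span C.F s = Submodule.span C.F t) :
    {x | Submodule.span (C.O x) s ≠ Submodule.span (C.O x) t}.Finite := by
  have := hs.to_subtype
  have := ht.to_subtype
  have h1 := C.finite_span_not_le (Subtype.val : s → V) (Subtype.val : t → V) (by
    intro i
    rw [Subtype.range_coe, ← hst]; exact Submodule.subset_span i.2)
  have h2 := C.finite_span_not_le (Subtype.val : t → V) (Subtype.val : s → V) (by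
    intro i
    rw [Subtype.range_coe, hst]; exact Submodule.subset_span i.2)
  simp only [Subtype.range_coe] at h1 h2
  refine (h1.union h2).subset fun x hx => ?_
  by_contra hcon
  simp only [Set.mem_union, Set.mem_setOf_eq, not_or, not_not] at hcon
  exact hx (le_antisymm hcon.1 hcon.2)

variable {C}

lemma SheafOrder.exists_gen {A : Type} [Ring A] [Algebra C.F A] [FiniteDimensional C.F A]
    (D : SheafOrder C A) : ∃ s : Set A, s.Finite ∧ Submodule.span C.F s = ⊤ ∧
      {x | (D.Λ x).toSubmodule ≠ Submodule.span (C.O x) s}.Finite := by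
  obtain ⟨t, ht⟩ := (Module.Finite.fg_top : (⊤ : Submodule C.F A).FG)
  obtain ⟨n, g, hg⟩ := D.lattice.2.2
  refine ⟨t, t.finite_toSet, ht, ?_⟩
  by_cases hex : ∃ x, (D.Λ x).toSubmodule = Submodule.span (C.O x) (Set.range g)
  · obtain ⟨x, hx⟩ := hex
    have hgt : Submodule.span C.F (Set.range g) = ⊤ := by
      have h1 := D.lattice.2.1 x
      simp only [hx] at h1
      rwa [Submodule.span_span_of_tower] at h1
    refine (hg.union (C.finite_set_span_ne (Set.finite_range g) t.finite_toSet
      (hgt.trans ht.symm))).subset fun y hy => ?_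
    by_contra hcon
    simp only [Set.mem_union, Set.mem_setOf_eq, not_or, not_not] at hcon
    exact hy (hcon.1.trans hcon.2)
  · push Not at hex
    exact hg.subset fun y _ => hex y

end GoodPoints

/-- Two algebras sitting as full corners of a common algebra. -/
structure CornerData {k : Type} [Field k] (C : AlgCurve k)
    (A₁ A₂ B : Type) [Ring A₁] [Algebra C.F A₁] [Ring A₂] [Algebra C.F A₂]
    [Ring B] [Algebra C.F B] where
  j₁ : A₁ →ₗ[C.F] B
  j₂ : A₂ →ₗ[C.F] B
  m₁ : ∀ a b, j₁ (a * b) = j₁ a * j₁ b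
  m₂ : ∀ a b, j₂ (a * b) = j₂ a * j₂ b
  i₁ : Function.Injective j₁
  i₂ : Function.Injective j₂
  r₁ : ∀ y, j₁ 1 * y = y → y * j₁ 1 = y → ∃ a, j₁ a = y
  r₂ : ∀ y, j₂ 1 * y = y → y * j₂ 1 = y → ∃ a, j₂ a = y
  c₁ : ∀ R : Type, ∀ [CommRing R] [Algebra R B],
    j₁ 1 ∈ corner R (j₁ 1) (j₂ 1) * corner R (j₂ 1) (j₁ 1)
  c₂ : ∀ R : Type, ∀ [CommRing R] [Algebra R B],
    j₂ 1 ∈ corner R (j₂ 1) (j₁ 1) * corner R (j₁ 1) (j₂ 1)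

namespace CornerData

variable {k : Type} [Field k] {C : AlgCurve k}
    {A₁ A₂ B : Type} [Ring A₁] [Algebra C.F A₁] [Ring A₂] [Algebra C.F A₂]
    [Ring B] [Algebra C.F B] (d : CornerData C A₁ A₂ B)

lemma corner_mul_le (R : Type) [CommRing R] [Algebra R B] (e f g : B) :
    corner R e f * corner R f g ≤ corner R e g := by
  rw [Submodule.mul_le]
  rintro a ⟨h1, h2⟩ b ⟨h3, h4⟩
  exact ⟨by rw [← mul_assoc, h1], by rw [mul_assoc, h4]⟩

lemma corner_mul_eq (R : Type) [CommRing R] [Algebra R B] (e f g : B)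
    (h : e ∈ corner R e f * corner R f e) :
    corner R e f * corner R f g = corner R e g := by
  refine le_antisymm (corner_mul_le R e f g) fun y hy => ?_
  have h1 : y = e * y := hy.1.symm
  rw [h1]
  have h2 : e * y ∈ corner R e f * corner R f e * corner R e g := Submodule.mul_mem_mul h hy
  rw [mul_assoc] at h2
  exact mul_le_mul_right (corner_mul_le R f e g) _ h2

lemma idem₁ : d.j₁ 1 * d.j₁ 1 = d.j₁ 1 := by rw [← d.m₁, mul_one]
lemma idem₂ : d.j₂ 1 * d.j₂ 1 = d.j₂ 1 := by rw [← d.m₂, mul_one]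

lemma range₁ : LinearMap.range d.j₁ = corner C.F (d.j₁ 1) (d.j₁ 1) := by
  ext y; constructor
  · rintro ⟨a, rfl⟩
    exact ⟨by rw [← d.m₁, one_mul], by rw [← d.m₁, mul_one]⟩
  · rintro ⟨h1, h2⟩; exact d.r₁ y h1 h2

lemma range₂ : LinearMap.range d.j₂ = corner C.F (d.j₂ 1) (d.j₂ 1) := by
  ext y; constructor
  · rintro ⟨a, rfl⟩
    exact ⟨by rw [← d.m₂, one_mul], by rw [← d.m₂, mul_one]⟩
  · rintro ⟨h1, h2⟩; exact d.r₂ y h1 h2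

lemma ecorner (R : Type) [CommRing R] [Algebra R B] {e : B} (he : e * e = e) (f : B) :
    corner R e e * corner R e f = corner R e f :=
  corner_mul_eq R e e f (by
    have h : e ∈ corner R e e := ⟨he, he⟩
    have := Submodule.mul_mem_mul h h
    rwa [he] at this)

lemma cornerf (R : Type) [CommRing R] [Algebra R B] {f : B} (hf : f * f = f) (e : B) :
    corner R e f * corner R f f = corner R e f := by
  refine le_antisymm (corner_mul_le R e f f) fun y hy => ?_
  have h := Submodule.mul_mem_mul hy (show f ∈ corner R f f from ⟨hf, hf⟩)
  rwa [hy.2] at h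

/-- A pair of mutually inverse lattices at a point. -/
structure Good (D₁ : SheafOrder C A₁) (D₂ : SheafOrder C A₂) (x : C.Point)
    (L M : Submodule (C.O x) B) : Prop where
  L_le : L ≤ corner (C.O x) (d.j₁ 1) (d.j₂ 1)
  M_le : M ≤ corner (C.O x) (d.j₂ 1) (d.j₁ 1)
  L_fg : L.FG
  M_fg : M.FG
  SL : (D₁.Λ x).toSubmodule.map (d.j₁.restrictScalars (C.O x)) * L ≤ L
  LS : L * (D₂.Λ x).toSubmodule.map (d.j₂.restrictScalars (C.O x)) ≤ L
  SM : (D₂.Λ x).toSubmodule.map (d.j₂.restrictScalars (C.O x)) * M ≤ M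
  MS : M * (D₁.Λ x).toSubmodule.map (d.j₁.restrictScalars (C.O x)) ≤ M
  LM : L * M = (D₁.Λ x).toSubmodule.map (d.j₁.restrictScalars (C.O x))
  ML : M * L = (D₂.Λ x).toSubmodule.map (d.j₂.restrictScalars (C.O x))
  Lspan : ∀ v ∈ corner C.F (d.j₁ 1) (d.j₂ 1), v ∈ Submodule.span C.F (L : Set B)
  Mspan : ∀ v ∈ corner C.F (d.j₂ 1) (d.j₁ 1), v ∈ Submodule.span C.F (M : Set B)

lemma map_pow_succ {R A : Type} [CommRing R] [Ring A] [Algebra R A] [Algebra R B]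
    (j : A →ₗ[R] B) (hj : ∀ a b, j (a * b) = j a * j b) (P : Submodule R A) (n : ℕ) :
    (P.map j) ^ (n + 1) = (P ^ (n + 1)).map j := by
  have hmul : ∀ X Y : Submodule R A, (X * Y).map j = X.map j * Y.map j := by
    intro X Y
    apply le_antisymm
    · rw [Submodule.map_le_iff_le_comap, Submodule.mul_le]
      intro a ha b hb
      rw [Submodule.mem_comap, hj]
      exact Submodule.mul_mem_mul ⟨a, ha, rfl⟩ ⟨b, hb, rfl⟩
    · rw [Submodule.mul_le]
      rintro _ ⟨a, ha, rfl⟩ _ ⟨b, hb, rfl⟩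
      exact ⟨a * b, Submodule.mul_mem_mul ha hb, hj a b⟩
  induction n with
  | zero => simp
  | succ n ih => rw [pow_succ, ih, ← hmul, ← pow_succ]

lemma span_of_full' {x : C.Point} (p : C.O x) (hp0 : p ≠ 0) (L : Submodule (C.O x) B) (v : B)
    (h : ∃ n : ℕ, (algebraMap (C.O x) C.F p) ^ n • v ∈ L) :
    v ∈ Submodule.span C.F (L : Set B) := by
  obtain ⟨n, hn⟩ := h
  have hpF : (algebraMap (C.O x) C.F p) ^ n ≠ 0 := by
    apply pow_ne_zero; rwa [Ne, FaithfulSMul.algebraMap_eq_zero_iff]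
  have := Submodule.smul_mem (Submodule.span C.F (L : Set B)) ((algebraMap (C.O x) C.F p) ^ n)⁻¹
    (Submodule.subset_span hn)
  rwa [smul_smul, inv_mul_cancel₀ hpF, one_smul] at this

lemma map_fs_comm {A : Type} [Ring A] [Algebra C.F A] (j : A →ₗ[C.F] B) {x : C.Point} (a : C.F)
    (X : Submodule (C.O x) A) :
    (fs a X).map (j.restrictScalars (C.O x)) = fs a (X.map (j.restrictScalars (C.O x))) := by
  ext y; constructor
  · rintro ⟨_, ⟨z, hz, rfl⟩, rfl⟩
    exact ⟨j z, ⟨z, hz, rfl⟩, map_smul j a z⟩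
  · rintro ⟨_, ⟨z, hz, rfl⟩, rfl⟩
    exact ⟨a • z, ⟨z, hz, rfl⟩, map_smul j a z⟩

variable [Algebra.IsCentral C.F A₁] [Nontrivial A₁] [Algebra.IsCentral C.F A₂] [Nontrivial A₂]
  [FiniteDimensional C.F A₁] [FiniteDimensional C.F A₂] [FiniteDimensional C.F B]

theorem exists_good (D₁ : SheafOrder C A₁) (h₁ : D₁.IsHereditary)
    (D₂ : SheafOrder C A₂) (h₂ : D₂.IsHereditary)
    (hidx : ∀ (x : C.Point) (e : ℕ), D₁.HasIndexAt x e ↔ D₂.HasIndexAt x e) :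
    ∃ s t : Set B, s.Finite ∧ t.Finite ∧ s ⊆ corner C.F (d.j₁ 1) (d.j₂ 1) ∧
      t ⊆ corner C.F (d.j₂ 1) (d.j₁ 1) ∧
      ∃ L M : ∀ x : C.Point, Submodule (C.O x) B, (∀ x, d.Good D₁ D₂ x (L x) (M x)) ∧
        {x | L x ≠ Submodule.span (C.O x) s ∨ M x ≠ Submodule.span (C.O x) t}.Finite := by
  obtain ⟨s₁, hs₁, hsp₁, hb₁⟩ := D₁.exists_gen
  obtain ⟨s₂, hs₂, hsp₂, hb₂⟩ := D₂.exists_gen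
  obtain ⟨bI, hbI⟩ := (IsNoetherian.noetherian (corner C.F (d.j₁ 1) (d.j₂ 1)))
  obtain ⟨bJ, hbJ⟩ := (IsNoetherian.noetherian (corner C.F (d.j₂ 1) (d.j₁ 1)))
  have ht₁ : Submodule.span C.F (d.j₁ '' s₁) = corner C.F (d.j₁ 1) (d.j₁ 1) := by
    rw [Submodule.span_image, hsp₁, Submodule.map_top, d.range₁]
  have ht₂ : Submodule.span C.F (d.j₂ '' s₂) = corner C.F (d.j₂ 1) (d.j₂ 1) := by
    rw [Submodule.span_image, hsp₂, Submodule.map_top, d.range₂]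
  set s : Set B := d.j₁ '' s₁ * (bI : Set B) * d.j₂ '' s₂ with hs
  set t : Set B := d.j₂ '' s₂ * (bJ : Set B) * d.j₁ '' s₁ with ht
  have hsfin : s.Finite := ((hs₁.image _).mul bI.finite_toSet).mul (hs₂.image _)
  have htfin : t.Finite := ((hs₂.image _).mul bJ.finite_toSet).mul (hs₁.image _)
  have hspan_s : Submodule.span C.F s = corner C.F (d.j₁ 1) (d.j₂ 1) := by
    rw [hs, ← Submodule.span_mul_span, ← Submodule.span_mul_span, ht₁, ht₂, hbI,
      ecorner _ d.idem₁, cornerf _ d.idem₂]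
  have hspan_t : Submodule.span C.F t = corner C.F (d.j₂ 1) (d.j₁ 1) := by
    rw [ht, ← Submodule.span_mul_span, ← Submodule.span_mul_span, ht₁, ht₂, hbJ,
      ecorner _ d.idem₂, cornerf _ d.idem₁]
  have hst : Submodule.span C.F (s * t) = Submodule.span C.F (d.j₁ '' s₁) := by
    rw [← Submodule.span_mul_span, hspan_s, hspan_t, ht₁]
    exact corner_mul_eq _ _ _ _ (d.c₁ _)
  have hts : Submodule.span C.F (t * s) = Submodule.span C.F (d.j₂ '' s₂) := by
    rw [← Submodule.span_mul_span, hspan_s, hspan_t, ht₂]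
    exact corner_mul_eq _ _ _ _ (d.c₂ _)
  have hf1 := C.finite_set_span_ne (hsfin.mul htfin) (hs₁.image d.j₁) hst
  have hf2 := C.finite_set_span_ne (htfin.mul hsfin) (hs₂.image d.j₂) hts
  have hs_sub : s ⊆ corner C.F (d.j₁ 1) (d.j₂ 1) := by
    rw [← hspan_s]; exact Submodule.subset_span
  have ht_sub : t ⊆ corner C.F (d.j₂ 1) (d.j₁ 1) := by
    rw [← hspan_t]; exact Submodule.subset_span
  have hbad := (hb₁.union hb₂).union (hf1.union hf2)
  set bad := ({x | (D₁.Λ x).toSubmodule ≠ Submodule.span (C.O x) s₁} ∪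
    {x | (D₂.Λ x).toSubmodule ≠ Submodule.span (C.O x) s₂}) ∪
    ({x | Submodule.span (C.O x) (s * t) ≠ Submodule.span (C.O x) (d.j₁ '' s₁)} ∪
    {x | Submodule.span (C.O x) (t * s) ≠ Submodule.span (C.O x) (d.j₂ '' s₂)}) with hbaddef
  have hss : ∀ x : C.Point, ∀ v ∈ corner C.F (d.j₁ 1) (d.j₂ 1),
      v ∈ Submodule.span C.F (Submodule.span (C.O x) s : Set B) := by
    intro x v hv
    rw [Submodule.span_span_of_tower, hspan_s]; exact hv
  have htt : ∀ x : C.Point, ∀ v ∈ corner C.F (d.j₂ 1) (d.j₁ 1),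
      v ∈ Submodule.span C.F (Submodule.span (C.O x) t : Set B) := by
    intro x v hv
    rw [Submodule.span_span_of_tower, hspan_t]; exact hv
  have hsle : ∀ x : C.Point, Submodule.span (C.O x) s ≤ corner (C.O x) (d.j₁ 1) (d.j₂ 1) :=
    fun x => Submodule.span_le.2 fun y hy => hs_sub hy
  have htle : ∀ x : C.Point, Submodule.span (C.O x) t ≤ corner (C.O x) (d.j₂ 1) (d.j₁ 1) :=
    fun x => Submodule.span_le.2 fun y hy => ht_sub hy
  have key : ∀ x : C.Point, ∃ L M : Submodule (C.O x) B, d.Good D₁ D₂ x L M ∧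
      (x ∉ bad → L = Submodule.span (C.O x) s ∧ M = Submodule.span (C.O x) t) := by
    intro x
    obtain ⟨p, hp0, hp⟩ := C.exists_unif x
    have H₁ := D₁.hOrd h₁ p hp0 hp d.j₁ d.m₁ d.i₁ d.r₁
    have H₂ := D₂.hOrd h₂ p hp0 hp d.j₂ d.m₂ d.i₂ d.r₂
    by_cases hx : x ∈ bad
    · obtain ⟨E, hE⟩ := (D₁.hOrd_self h₁ p hp0 hp).exists_index (C.maximalIdeal_eq p hp0 hp) hp0
      have hE2 := ((D₂.hasIndexAt_iff h₂ p hp0 hp (E+1)).1 ((hidx x _).1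
        ((D₁.hasIndexAt_iff h₁ p hp0 hp (E+1)).2 ⟨Nat.succ_pos _, hE⟩))).2
      obtain ⟨L, M, a1, a2, a3, a4, a5, a6, a7, a8, a9, a10, a11, a12⟩ :=
        H₁.local_morita (C.maximalIdeal_eq p hp0 hp) hp0 H₂ (d.c₂ _) E
          (by rw [map_pow_succ (d.j₁.restrictScalars (C.O x)) d.m₁, hE, map_fs_comm])
          (by rw [map_pow_succ (d.j₂.restrictScalars (C.O x)) d.m₂, hE2, map_fs_comm])
          (Submodule.span (C.O x) s) (hsle x) (Submodule.fg_span hsfin)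
          (fun v hv => C.full_of_span p hp0 hp _ v (hss x v hv))
      exact ⟨L, M, ⟨a1, a2, a3, a4, a5, a6, a7, a8, a9, a10,
        fun v hv => span_of_full' p hp0 L v (a11 v hv),
        fun v hv => span_of_full' p hp0 M v (a12 v hv)⟩, fun h => absurd hx h⟩
    · refine ⟨Submodule.span (C.O x) s, Submodule.span (C.O x) t, ?_, fun _ => ⟨rfl, rfl⟩⟩
      simp only [hbaddef, Set.mem_union, Set.mem_setOf_eq, not_or, not_not] at hx
      obtain ⟨⟨e1, e2⟩, e3, e4⟩ := hx
      have e1' : (D₁.Λ x).toSubmodule.map (d.j₁.restrictScalars (C.O x)) =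
          Submodule.span (C.O x) (d.j₁ '' s₁) := by
        rw [e1]; exact (Submodule.span_image (d.j₁.restrictScalars (C.O x))).symm
      have e2' : (D₂.Λ x).toSubmodule.map (d.j₂.restrictScalars (C.O x)) =
          Submodule.span (C.O x) (d.j₂ '' s₂) := by
        rw [e2]; exact (Submodule.span_image (d.j₂.restrictScalars (C.O x))).symm
      have eL : Submodule.span (C.O x) s = (D₁.Λ x).toSubmodule.map (d.j₁.restrictScalars (C.O x)) *
          Submodule.span (C.O x) bI * (D₂.Λ x).toSubmodule.map (d.j₂.restrictScalars (C.O x)) := by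
        rw [e1', e2', Submodule.span_mul_span, Submodule.span_mul_span]
      have eM : Submodule.span (C.O x) t = (D₂.Λ x).toSubmodule.map (d.j₂.restrictScalars (C.O x)) *
          Submodule.span (C.O x) bJ * (D₁.Λ x).toSubmodule.map (d.j₁.restrictScalars (C.O x)) := by
        rw [e1', e2', Submodule.span_mul_span, Submodule.span_mul_span]
      refine ⟨hsle x, htle x, Submodule.fg_span hsfin, Submodule.fg_span htfin, ?_, ?_, ?_, ?_,
        ?_, ?_, hss x, htt x⟩
      · rw [eL, ← mul_assoc, ← mul_assoc]
        exact mul_le_mul_left (mul_le_mul_left H₁.SS _) _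
      · rw [eL, mul_assoc]
        exact mul_le_mul_right H₂.SS _
      · rw [eM, ← mul_assoc, ← mul_assoc]
        exact mul_le_mul_left (mul_le_mul_left H₂.SS _) _
      · rw [eM, mul_assoc]
        exact mul_le_mul_right H₁.SS _
      · rw [Submodule.span_mul_span, e3, e1']
      · rw [Submodule.span_mul_span, e4, e2']
  choose L M hG hLM using key
  refine ⟨s, t, hsfin, htfin, hs_sub, ht_sub, L, M, hG, hbad.subset fun x hx => ?_⟩
  by_contra hcon
  obtain ⟨h1, h2⟩ := hLM x hcon
  rcases hx with h | h
  · exact h h1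
  · exact h h2

end CornerData

namespace CornerData

variable {k : Type} [Field k] {C : AlgCurve k}
    {A₁ A₂ B : Type} [Ring A₁] [Algebra C.F A₁] [Ring A₂] [Algebra C.F A₂]
    [Ring B] [Algebra C.F B] (d : CornerData C A₁ A₂ B)

/-- the generic bimodule `e B f` -/
def I : Type := ↥(corner C.F (d.j₁ 1) (d.j₂ 1))

instance : AddCommGroup d.I := inferInstanceAs (AddCommGroup ↥(corner C.F (d.j₁ 1) (d.j₂ 1)))
instance : Module C.F d.I := inferInstanceAs (Module C.F ↥(corner C.F (d.j₁ 1) (d.j₂ 1)))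

/-- the inclusion into `B` -/
def vI : d.I →ₗ[C.F] B := (corner C.F (d.j₁ 1) (d.j₂ 1)).subtype

lemma vI_inj : Function.Injective d.vI := Subtype.val_injective

lemma e_vI (v : d.I) : d.j₁ 1 * d.vI v = d.vI v := v.2.1
lemma vI_f (v : d.I) : d.vI v * d.j₂ 1 = d.vI v := v.2.2

/-- constructor -/
def mkI (b : B) (h : b ∈ corner C.F (d.j₁ 1) (d.j₂ 1)) : d.I := ⟨b, h⟩

lemma vI_mk (b : B) (h) : d.vI (d.mkI b h) = b := rfl

lemma j1_corner (a : A₁) : d.j₁ a ∈ corner C.F (d.j₁ 1) (d.j₁ 1) :=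
  ⟨by rw [← d.m₁, one_mul], by rw [← d.m₁, mul_one]⟩

lemma j2_corner (a : A₂) : d.j₂ a ∈ corner C.F (d.j₂ 1) (d.j₂ 1) :=
  ⟨by rw [← d.m₂, one_mul], by rw [← d.m₂, mul_one]⟩

instance : SMul A₁ d.I := ⟨fun a v => d.mkI (d.j₁ a * d.vI v)
  (corner_mul_le _ _ _ _ (Submodule.mul_mem_mul (d.j1_corner a) v.2))⟩

instance : SMul A₂ᵐᵒᵖ d.I := ⟨fun a v => d.mkI (d.vI v * d.j₂ a.unop)
  (corner_mul_le _ _ _ _ (Submodule.mul_mem_mul v.2 (d.j2_corner _)))⟩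

lemma vI_smul1 (a : A₁) (v : d.I) : d.vI (a • v) = d.j₁ a * d.vI v := rfl
lemma vI_smul2 (a : A₂ᵐᵒᵖ) (v : d.I) : d.vI (a • v) = d.vI v * d.j₂ a.unop := rfl

instance : Module A₁ d.I where
  one_smul v := d.vI_inj (by rw [vI_smul1, e_vI])
  mul_smul a b v := d.vI_inj (by simp only [vI_smul1, d.m₁, mul_assoc])
  smul_zero a := d.vI_inj (by rw [vI_smul1, map_zero, mul_zero])
  smul_add a v w := d.vI_inj (by simp only [vI_smul1, map_add, mul_add])
  add_smul a b v := d.vI_inj (by simp only [vI_smul1, map_add, add_mul])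
  zero_smul v := d.vI_inj (by rw [vI_smul1, map_zero, zero_mul, map_zero])

instance : Module A₂ᵐᵒᵖ d.I where
  one_smul v := d.vI_inj (by rw [vI_smul2, MulOpposite.unop_one, vI_f])
  mul_smul a b v := d.vI_inj (by simp only [vI_smul2, MulOpposite.unop_mul, d.m₂, mul_assoc])
  smul_zero a := d.vI_inj (by rw [vI_smul2, map_zero, zero_mul])
  smul_add a v w := d.vI_inj (by simp only [vI_smul2, map_add, add_mul])
  add_smul a b v := d.vI_inj (by simp only [vI_smul2, MulOpposite.unop_add, map_add, mul_add])
  zero_smul v := d.vI_inj (by rw [vI_smul2, MulOpposite.unop_zero, map_zero, mul_zero, map_zero])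

instance : SMulCommClass A₁ A₂ᵐᵒᵖ d.I :=
  ⟨fun a b v => d.vI_inj (by simp only [vI_smul2, vI_smul1, mul_assoc])⟩

instance : IsScalarTower C.F A₁ d.I :=
  ⟨fun a b v => d.vI_inj (by simp only [vI_smul1, map_smul, smul_mul_assoc])⟩

instance : IsScalarTower C.F A₂ᵐᵒᵖ d.I :=
  ⟨fun a b v => d.vI_inj (by
    simp only [vI_smul2, map_smul, MulOpposite.unop_smul, mul_smul_comm])⟩

/-- the generic bimodule in the other direction is the one for the swapped data -/
def swap : CornerData C A₂ A₁ B where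
  j₁ := d.j₂
  j₂ := d.j₁
  m₁ := d.m₂
  m₂ := d.m₁
  i₁ := d.i₂
  i₂ := d.i₁
  r₁ := d.r₂
  r₂ := d.r₁
  c₁ := fun R _ _ => d.c₂ R
  c₂ := fun R _ _ => d.c₁ R

/-- the first pairing -/
noncomputable def mu (v : d.I) (w : d.swap.I) : A₁ :=
  (d.r₁ (d.vI v * d.swap.vI w) (by rw [← mul_assoc, e_vI])
    (by rw [mul_assoc]; congr 1; exact d.swap.vI_f w)).choose

lemma j_mu (v : d.I) (w : d.swap.I) : d.j₁ (d.mu v w) = d.vI v * d.swap.vI w :=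
  (d.r₁ (d.vI v * d.swap.vI w) (by rw [← mul_assoc, e_vI])
    (by rw [mul_assoc]; congr 1; exact d.swap.vI_f w)).choose_spec

/-- the second pairing -/
noncomputable def nu (w : d.swap.I) (v : d.I) : A₂ := d.swap.mu w v

lemma j_nu (w : d.swap.I) (v : d.I) : d.j₂ (d.nu w v) = d.swap.vI w * d.vI v :=
  d.swap.j_mu w v

lemma vs_smul1 (a : A₂) (w : d.swap.I) : d.swap.vI (a • w) = d.j₂ a * d.swap.vI w := rfl
lemma vs_smul2 (a : A₁ᵐᵒᵖ) (w : d.swap.I) : d.swap.vI (a • w) = d.swap.vI w * d.j₁ a.unop := rfl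

/-- The lattice in `d.I` from a lattice in `B`. -/
def lat {x : C.Point} (L : Submodule (C.O x) B) : Submodule (C.O x) d.I :=
  L.comap (d.vI.restrictScalars (C.O x))

lemma mem_lat {x : C.Point} {L : Submodule (C.O x) B} {v : d.I} : v ∈ d.lat L ↔ d.vI v ∈ L :=
  Iff.rfl

lemma map_lat {x : C.Point} (L : Submodule (C.O x) B)
    (hL : L ≤ corner (C.O x) (d.j₁ 1) (d.j₂ 1)) :
    (d.lat L).map (d.vI.restrictScalars (C.O x)) = L := by
  apply le_antisymm
  · rintro _ ⟨v, hv, rfl⟩; exact hv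
  · intro y hy; exact ⟨d.mkI y (hL hy), hy, rfl⟩

lemma lattice_family (L : ∀ x : C.Point, Submodule (C.O x) B)
    (hL : ∀ x, L x ≤ corner (C.O x) (d.j₁ 1) (d.j₂ 1)) (hfg : ∀ x, (L x).FG)
    (hsp : ∀ x, ∀ v ∈ corner C.F (d.j₁ 1) (d.j₂ 1), v ∈ Submodule.span C.F (L x : Set B))
    (s : Set B) (hs : s.Finite) (hsc : s ⊆ corner C.F (d.j₁ 1) (d.j₂ 1))
    (hfin : {x | L x ≠ Submodule.span (C.O x) s}.Finite) :
    IsLatticeFamily C d.I (fun x => d.lat (L x)) := by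
  refine ⟨fun x => ?_, fun x => ?_, ?_⟩
  · rw [Module.Finite.iff_fg]
    refine Submodule.fg_of_fg_map_injective (d.vI.restrictScalars (C.O x)) d.vI_inj ?_
    rw [d.map_lat _ (hL x)]; exact hfg x
  · rw [eq_top_iff]
    intro v _
    have h1 : (L x : Set B) = d.vI '' (d.lat (L x) : Set d.I) := by
      conv_lhs => rw [← d.map_lat _ (hL x)]
      rfl
    have h2 := hsp x (d.vI v) v.2
    rw [h1, Submodule.span_image] at h2
    obtain ⟨w, hw, hwv⟩ := h2
    rwa [← d.vI_inj hwv]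
  · have := hs.to_subtype
    obtain ⟨n, ⟨φ⟩⟩ := Finite.exists_equiv_fin s
    refine ⟨n, fun i => d.mkI (φ.symm i) (hsc (φ.symm i).2), hfin.subset fun x hx h => hx ?_⟩
    apply Submodule.map_injective_of_injective (f := d.vI.restrictScalars (C.O x)) d.vI_inj
    rw [d.map_lat _ (hL x), h, Submodule.map_span, ← Set.range_comp]
    congr 1
    ext y; constructor
    · intro hy; exact ⟨φ ⟨y, hy⟩, by simp [d.vI_mk]⟩
    · rintro ⟨i, rfl⟩; exact (φ.symm i).2

lemma mu_local_aux {R : Type} [CommRing R] [Module R d.I] [Module R d.swap.I] [Algebra R A₁]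
    [Algebra R B] (j : A₁ →ₗ[R] B) (hj : ∀ a, j a = d.j₁ a) (L M : Submodule R B)
    (hL : L ≤ corner R (d.j₁ 1) (d.j₂ 1)) (hM : M ≤ corner R (d.j₂ 1) (d.j₁ 1))
    (S : Submodule R A₁) (h : L * M = S.map j)
    (X : Set d.I) (hX : ∀ v, v ∈ X ↔ d.vI v ∈ L)
    (Y : Set d.swap.I) (hY : ∀ v, v ∈ Y ↔ d.swap.vI v ∈ M) :
    Submodule.span R {a : A₁ | ∃ v ∈ X, ∃ w ∈ Y, a = d.mu v w} = S := by
  have hji : Function.Injective j := fun a b hab => d.i₁ (by rwa [← hj, ← hj])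
  apply le_antisymm
  · rw [Submodule.span_le]
    rintro _ ⟨v, hv, w, hw, rfl⟩
    have h1 : j (d.mu v w) ∈ S.map j := by
      rw [hj, j_mu, ← h]
      exact Submodule.mul_mem_mul ((hX v).1 hv) ((hY w).1 hw)
    obtain ⟨a, ha, hab⟩ := h1
    rw [← hji hab]; exact ha
  · apply (Submodule.map_le_map_iff_of_injective hji _ _).1
    rw [← h, Submodule.mul_le]
    intro l hl m hm
    refine ⟨d.mu (d.mkI l (hL hl)) (d.swap.mkI m (hM hm)), Submodule.subset_span
      ⟨_, (hX _).2 hl, _, (hY _).2 hm, rfl⟩, ?_⟩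
    rw [hj, j_mu]; rfl

/-- The Morita context. -/
theorem exists_context (D₁ : SheafOrder C A₁) (D₂ : SheafOrder C A₂)
    (s t : Set B) (hs : s.Finite) (ht : t.Finite) (hsc : s ⊆ corner C.F (d.j₁ 1) (d.j₂ 1))
    (htc : t ⊆ corner C.F (d.j₂ 1) (d.j₁ 1))
    (L M : ∀ x : C.Point, Submodule (C.O x) B) (hG : ∀ x, d.Good D₁ D₂ x (L x) (M x))
    (hfin : {x | L x ≠ Submodule.span (C.O x) s ∨ M x ≠ Submodule.span (C.O x) t}.Finite) :
    Nonempty (MoritaContext C A₁ A₂ D₁ D₂) := by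
  refine ⟨{
    I := d.I
    J := d.swap.I
    μ := d.mu
    ν := d.nu
    LI := fun x => d.lat (L x)
    LJ := fun x => d.swap.lat (M x)
    μ_add_left := fun v v' w => d.i₁ (by simp only [j_mu, map_add, add_mul])
    μ_add_right := fun v w w' => d.i₁ (by simp only [j_mu, map_add, mul_add])
    ν_add_left := fun v v' w => d.i₂ (by simp only [j_nu, map_add, add_mul])
    ν_add_right := fun v w w' => d.i₂ (by simp only [j_nu, map_add, mul_add])
    μ_smul_left := fun a v w => d.i₁ (by simp only [j_mu, vI_smul1, d.m₁, mul_assoc])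
    μ_smul_right := fun a v w => d.i₁ (by
      simp only [j_mu, vs_smul2, d.m₁, mul_assoc, MulOpposite.unop_op])
    μ_balanced := fun a v w => d.i₁ (by
      simp only [j_mu, vs_smul1, vI_smul2, mul_assoc, MulOpposite.unop_op])
    ν_smul_left := fun a v w => d.i₂ (by simp only [j_nu, vs_smul1, d.m₂, mul_assoc])
    ν_smul_right := fun a v w => d.i₂ (by
      simp only [j_nu, vI_smul2, d.m₂, mul_assoc, MulOpposite.unop_op])
    ν_balanced := fun a v w => d.i₂ (by
      simp only [j_nu, vs_smul2, vI_smul1, mul_assoc, MulOpposite.unop_op])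
    assoc₁ := fun v w v' => d.vI_inj (by
      simp only [j_mu, j_nu, vI_smul1, vI_smul2, mul_assoc, MulOpposite.unop_op])
    assoc₂ := fun v w v' => d.swap.vI_inj (by
      simp only [j_mu, j_nu, vs_smul1, vs_smul2, mul_assoc, MulOpposite.unop_op])
    μ_surjective := ?_
    ν_surjective := ?_
    latticeI := ?_
    latticeJ := ?_
    stabI_left := ?_
    stabI_right := ?_
    stabJ_left := ?_
    stabJ_right := ?_
    μ_local := ?_
    ν_local := ?_ }⟩
  · have := d.mu_local_aux d.j₁ (fun _ => rfl) (corner C.F (d.j₁ 1) (d.j₂ 1))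
      (corner C.F (d.j₂ 1) (d.j₁ 1)) le_rfl le_rfl ⊤
      (by rw [corner_mul_eq _ _ _ _ (d.c₁ _), Submodule.map_top, d.range₁])
      Set.univ (fun v => ⟨fun _ => v.2, fun _ => trivial⟩) Set.univ (fun v => ⟨fun _ => v.2, fun _ => trivial⟩)
    simpa using this
  · have := d.swap.mu_local_aux d.j₂ (fun _ => rfl) (corner C.F (d.j₂ 1) (d.j₁ 1))
      (corner C.F (d.j₁ 1) (d.j₂ 1)) le_rfl le_rfl ⊤
      (by rw [corner_mul_eq _ _ _ _ (d.c₂ _), Submodule.map_top, d.range₂])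
      Set.univ (fun v => ⟨fun _ => v.2, fun _ => trivial⟩) Set.univ (fun v => ⟨fun _ => v.2, fun _ => trivial⟩)
    simp only [Set.mem_univ, true_and] at this
    exact this
  · exact d.lattice_family L (fun x => (hG x).L_le) (fun x => (hG x).L_fg) (fun x => (hG x).Lspan)
      s hs hsc (hfin.subset fun x hx => Or.inl hx)
  · exact d.swap.lattice_family M (fun x => (hG x).M_le) (fun x => (hG x).M_fg)
      (fun x => (hG x).Mspan) t ht htc (hfin.subset fun x hx => Or.inr hx)
  · intro x a ha v hv
    exact (hG x).SL (Submodule.mul_mem_mul ⟨a, ha, rfl⟩ hv)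
  · intro x a ha v hv
    exact (hG x).LS (Submodule.mul_mem_mul hv ⟨a, ha, rfl⟩)
  · intro x a ha v hv
    exact (hG x).SM (Submodule.mul_mem_mul ⟨a, ha, rfl⟩ hv)
  · intro x a ha v hv
    exact (hG x).MS (Submodule.mul_mem_mul hv ⟨a, ha, rfl⟩)
  · intro x
    exact d.mu_local_aux (d.j₁.restrictScalars (C.O x)) (fun _ => rfl) (L x) (M x) (hG x).L_le
      (hG x).M_le _ (hG x).LM _ (fun v => Iff.rfl) _ (fun v => Iff.rfl)
  · intro x
    exact d.swap.mu_local_aux (d.j₂.restrictScalars (C.O x)) (fun _ => rfl) (M x) (L x) (hG x).M_le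
      (hG x).L_le _ (hG x).ML _ (fun v => Iff.rfl) _ (fun v => Iff.rfl)

end CornerData

section BrauerCorner

lemma mem_corner_mul_of_sum {R B : Type} [CommRing R] [Ring B] [Algebra R B] {n : ℕ} (e f : B)
    (he : e * e = e) (hf : f * f = f) (a b : Fin n → B) (h : ∑ i, a i * f * b i = 1) :
    e ∈ corner R e f * corner R f e := by
  have h1 : e = ∑ i, (e * a i * f) * (f * b i * e) := by
    have h2 : ∀ i, (e * a i * f) * (f * b i * e) = e * (a i * f * b i) * e := by
      intro i
      calc (e * a i * f) * (f * b i * e) = e * a i * (f * f) * b i * e := by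
            simp only [mul_assoc]
        _ = _ := by rw [hf]; simp only [mul_assoc]
    simp_rw [h2]
    rw [← Finset.sum_mul, ← Finset.mul_sum, h, mul_one, he]
  rw [h1]
  refine Submodule.sum_mem _ fun i _ => Submodule.mul_mem_mul ?_ ?_
  · rw [← h1]
    exact ⟨by rw [mul_assoc, ← mul_assoc, he, ← mul_assoc], by rw [mul_assoc, hf]⟩
  · rw [← h1]
    exact ⟨by rw [mul_assoc, ← mul_assoc, hf, ← mul_assoc], by rw [mul_assoc, he]⟩

lemma matrix_sum_one {A : Type} [Ring A] {n : ℕ} (i0 : Fin n) :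
    ∑ i, Matrix.single i i0 (1 : A) * Matrix.single i0 i0 1 * Matrix.single i0 i 1 = 1 := by
  simp only [Matrix.single_mul_single_same, mul_one]
  ext a b
  simp [Matrix.sum_apply, Matrix.single_apply, Matrix.one_apply, ite_and]

lemma matrix_corner {A : Type} [Ring A] {n : ℕ} (i0 : Fin n) (y : Matrix (Fin n) (Fin n) A)
    (h1 : Matrix.single i0 i0 1 * y = y) (h2 : y * Matrix.single i0 i0 1 = y) :
    Matrix.single i0 i0 (y i0 i0) = y := by
  conv_rhs => rw [← h1, ← h2, ← mul_assoc, Matrix.single_mul_mul_single, one_mul, mul_one]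

theorem exists_cornerData {k : Type} [Field k] {C : AlgCurve k}
    {A₁ A₂ : Type} [Ring A₁] [Algebra C.F A₁] [Ring A₂] [Algebra C.F A₂] (n m : ℕ) (hn : 0 < n)
    (hm : 0 < m) (Φ : Matrix (Fin n) (Fin n) A₁ ≃ₐ[C.F] Matrix (Fin m) (Fin m) A₂) :
    Nonempty (CornerData C A₁ A₂ (Matrix (Fin m) (Fin m) A₂)) := by
  let i0 : Fin n := ⟨0, hn⟩
  let j0 : Fin m := ⟨0, hm⟩
  have hsum1 : ∑ i, Φ (Matrix.single i i0 1) * Φ (Matrix.single i0 i0 1) *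
      Φ (Matrix.single i0 i 1) = 1 := by
    simp_rw [← map_mul]
    rw [← map_sum, matrix_sum_one, map_one]
  have hsum2 := matrix_sum_one (A := A₂) j0
  have he1 : Φ (Matrix.single i0 i0 1) * Φ (Matrix.single i0 i0 1) = Φ (Matrix.single i0 i0 1) := by
    rw [← map_mul, Matrix.single_mul_single_same, mul_one]
  have he2 : Matrix.single j0 j0 (1 : A₂) * Matrix.single j0 j0 1 = Matrix.single j0 j0 1 := by
    rw [Matrix.single_mul_single_same, mul_one]
  refine ⟨{
    j₁ := Φ.toLinearMap ∘ₗ Matrix.singleLinearMap C.F i0 i0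
    j₂ := Matrix.singleLinearMap C.F j0 j0
    m₁ := fun a b => ?_
    m₂ := fun a b => ?_
    i₁ := ?_
    i₂ := ?_
    r₁ := ?_
    r₂ := ?_
    c₁ := fun R _ _ => mem_corner_mul_of_sum _ _ he1 he2 _ _ hsum2
    c₂ := fun R _ _ => mem_corner_mul_of_sum _ _ he2 he1 _ _ hsum1 }⟩
  · change Φ (Matrix.single i0 i0 _) = Φ (Matrix.single i0 i0 _) * Φ (Matrix.single i0 i0 _)
    rw [← map_mul, Matrix.single_mul_single_same]
  · change (Matrix.single j0 j0 _) = (Matrix.single j0 j0 _) * (Matrix.single j0 j0 _)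
    rw [Matrix.single_mul_single_same]
  · intro a b hab
    have := Φ.injective hab
    have h2 := congrFun (congrFun this i0) i0
    simpa using h2
  · intro a b hab
    have h2 := congrFun (congrFun hab j0) j0
    simpa using h2
  · intro y h1 h2
    refine ⟨(Φ.symm y) i0 i0, ?_⟩
    change Φ (Matrix.single i0 i0 _) = _
    rw [matrix_corner i0 (Φ.symm y), AlgEquiv.apply_symm_apply]
    · apply Φ.injective; rw [map_mul, AlgEquiv.apply_symm_apply]; exact h1
    · apply Φ.injective; rw [map_mul, AlgEquiv.apply_symm_apply]; exact h2
  · intro y h1 h2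
    exact ⟨y j0 j0, matrix_corner j0 y h1 h2⟩

theorem morita_of_brauer {k : Type} [Field k] (C : AlgCurve k)
    (A₁ : Type) [Ring A₁] [Algebra C.F A₁]
    [Algebra.IsCentral C.F A₁] [IsSimpleRing A₁] [FiniteDimensional C.F A₁]
    (A₂ : Type) [Ring A₂] [Algebra C.F A₂]
    [Algebra.IsCentral C.F A₂] [IsSimpleRing A₂] [FiniteDimensional C.F A₂]
    (D₁ : SheafOrder C A₁) (h₁ : D₁.IsHereditary)
    (D₂ : SheafOrder C A₂) (h₂ : D₂.IsHereditary)
    (hB : BrauerEquivalent C.F A₁ A₂)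
    (hidx : ∀ (x : C.Point) (e : ℕ), D₁.HasIndexAt x e ↔ D₂.HasIndexAt x e) :
    Nonempty (MoritaContext C A₁ A₂ D₁ D₂) := by
  obtain ⟨n, m, hn, hm, ⟨Φ⟩⟩ := hB
  obtain ⟨d⟩ := exists_cornerData n m hn hm Φ
  obtain ⟨s, t, hs, ht, hsc, htc, L, M, hG, hfin⟩ := d.exists_good D₁ h₁ D₂ h₂ hidx
  exact d.exists_context D₁ D₂ s t hs ht hsc htc L M hG hfin

end BrauerCorner

/-- Endomorphism rings of f.g. modules over a simple algebra are Brauer equivalent to it. -/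
theorem brauer_of_end {F A₁ A₂ I : Type} [Field F] [Ring A₁] [Algebra F A₁] [Ring A₂]
    [Algebra F A₂] [IsSimpleRing A₂] [FiniteDimensional F A₂] [AddCommGroup I] [Module F I]
    [Module A₂ᵐᵒᵖ I] [IsScalarTower F A₂ᵐᵒᵖ I] [Module.Finite A₂ᵐᵒᵖ I] [Nontrivial I]
    [SMulCommClass A₂ᵐᵒᵖ F I]
    (φ : A₁ ≃ₐ[F] Module.End A₂ᵐᵒᵖ I) : BrauerEquivalent F A₁ A₂ := by
  have : Module.Finite F A₂ᵐᵒᵖ := Module.Finite.equiv (MulOpposite.opLinearEquiv F)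
  have : IsArtinianRing A₂ᵐᵒᵖ := IsArtinianRing.of_finite F _
  obtain ⟨b, hb, T, hT, ⟨eT⟩⟩ := (IsSimpleRing.isIsotypic A₂ᵐᵒᵖ A₂ᵐᵒᵖ).linearEquiv_fun
  have hI : IsIsotypicOfType A₂ᵐᵒᵖ I T := by
    intro m hm
    obtain ⟨J, ⟨e⟩⟩ := IsSemisimpleRing.exists_linearEquiv_ideal_of_isSimpleModule A₂ᵐᵒᵖ m
    have : IsSimpleModule A₂ᵐᵒᵖ J := IsSimpleModule.congr e.symm
    obtain ⟨e'⟩ := IsSimpleRing.isIsotypic A₂ᵐᵒᵖ A₂ᵐᵒᵖ T J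
    exact ⟨e.trans e'⟩
  obtain ⟨r, ⟨eI⟩⟩ := hI.linearEquiv_fun
  have hr : 0 < r := by
    rcases Nat.eq_zero_or_pos r with rfl | h
    · exact absurd eI.toEquiv.subsingleton (not_subsingleton I)
    · exact h
  let E := Module.End A₂ᵐᵒᵖ T
  have φ1 : A₁ ≃ₐ[F] Matrix (Fin r) (Fin r) E :=
    φ.trans ((eI.conjAlgEquiv F).trans (endVecAlgEquivMatrixEnd ..))
  have φ2 : A₂ ≃ₐ[F] Matrix (Fin b) (Fin b) E :=
    (AlgEquiv.opOp F A₂).trans ((AlgEquiv.moduleEndSelf F).trans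
      ((eT.conjAlgEquiv F).trans (endVecAlgEquivMatrixEnd ..)))
  refine ⟨b, r, Nat.pos_of_ne_zero hb.out, hr, ⟨?_⟩⟩
  exact (φ1.mapMatrix.trans (Matrix.compAlgEquiv (Fin b) (Fin r) E F)).trans
    ((Matrix.reindexAlgEquiv F E (Equiv.prodComm _ _)).trans
      (φ2.mapMatrix.trans (Matrix.compAlgEquiv (Fin r) (Fin b) E F)).symm)

namespace MoritaContext

variable {k : Type} [Field k] {C : AlgCurve k}
    {A₁ : Type} [Ring A₁] [Algebra C.F A₁] {A₂ : Type} [Ring A₂] [Algebra C.F A₂]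
    {D₁ : SheafOrder C A₁} {D₂ : SheafOrder C A₂}

attribute [instance] acgI acgJ modFI modFJ mod1I mod2I commI tow1I tow2I mod2J mod1J commJ
  tow2J tow1J

variable (c : MoritaContext C A₁ A₂ D₁ D₂)

/-- the symmetric context -/
def symm : MoritaContext C A₂ A₁ D₂ D₁ where
  I := c.J
  J := c.I
  μ := c.ν
  ν := c.μ
  μ_add_left := c.ν_add_left
  μ_add_right := c.ν_add_right
  ν_add_left := c.μ_add_left
  ν_add_right := c.μ_add_right
  μ_smul_left := c.ν_smul_left
  μ_smul_right := fun b w v => c.ν_smul_right b w v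
  μ_balanced := c.ν_balanced
  ν_smul_left := c.μ_smul_left
  ν_smul_right := c.μ_smul_right
  ν_balanced := c.μ_balanced
  assoc₁ := c.assoc₂
  assoc₂ := c.assoc₁
  μ_surjective := c.ν_surjective
  ν_surjective := c.μ_surjective
  LI := c.LJ
  LJ := c.LI
  latticeI := c.latticeJ
  latticeJ := c.latticeI
  stabI_left := c.stabJ_left
  stabI_right := c.stabJ_right
  stabJ_left := c.stabI_left
  stabJ_right := c.stabI_right
  μ_local := c.ν_local
  ν_local := c.μ_local

lemma μ_zero_left (w : c.J) : c.μ 0 w = 0 := by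
  have := c.μ_add_left 0 0 w
  simpa using this

lemma μ_sum_left {ι : Type} (s : Finset ι) (v : ι → c.I) (w : c.J) :
    c.μ (∑ i ∈ s, v i) w = ∑ i ∈ s, c.μ (v i) w :=
  map_sum (AddMonoidHom.mk' (fun v => c.μ v w) (fun a b => c.μ_add_left a b w)) v s

lemma one_eq_sum : ∃ (n : ℕ) (v : Fin n → c.I) (w : Fin n → c.J), ∑ i, c.μ (v i) (w i) = 1 := by
  have h : (1 : A₁) ∈ Submodule.span C.F {a : A₁ | ∃ v w, a = c.μ v w} := by
    rw [c.μ_surjective]; trivial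
  obtain ⟨n, f, g, hfg⟩ := Submodule.mem_span_set'.1 h
  choose v w hvw using fun i => (g i).2
  refine ⟨n, fun i => (f i • (1 : A₁)) • v i, w, ?_⟩
  refine Eq.trans ?_ hfg
  refine Finset.sum_congr rfl fun i _ => ?_
  rw [c.μ_smul_left, hvw, smul_mul_assoc, one_mul]

theorem brauer (c : MoritaContext C A₁ A₂ D₁ D₂) [Nontrivial A₁] [IsSimpleRing A₂] [FiniteDimensional C.F A₂] :
    BrauerEquivalent C.F A₁ A₂ := by
  obtain ⟨n, v, w, hvw⟩ := c.one_eq_sum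
  have key : ∀ y : c.I, y = ∑ i, MulOpposite.op (c.ν (w i) y) • v i := by
    intro y
    conv_lhs => rw [← one_smul A₁ y, ← hvw, Finset.sum_smul]
    exact Finset.sum_congr rfl fun i _ => c.assoc₁ _ _ _
  have : Module.Finite A₂ᵐᵒᵖ c.I := by
    classical
    refine ⟨⟨Finset.univ.image v, ?_⟩⟩
    rw [eq_top_iff]
    intro y _
    rw [key y]
    exact Submodule.sum_mem _ fun i _ => Submodule.smul_mem _ _ (Submodule.subset_span (by simp))
  have : Nontrivial c.I := by
    by_contra hcon
    rw [not_nontrivial_iff_subsingleton] at hcon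
    have h0 : (0 : A₁) = 1 := by
      rw [← hvw]
      refine (Finset.sum_eq_zero fun i _ => ?_).symm
      rw [Subsingleton.elim (v i) 0, c.μ_zero_left]
    exact zero_ne_one h0
  have : SMulCommClass A₂ᵐᵒᵖ C.F c.I := by
    refine ⟨fun b f y => ?_⟩
    have h1 : f • y = (f • (1 : A₂ᵐᵒᵖ)) • y := by rw [smul_assoc, one_smul]
    have h2 : f • b • y = (f • b) • y := (smul_assoc _ _ _).symm
    rw [h1, h2, smul_smul, mul_smul_comm, mul_one]
  have : SMulCommClass C.F A₂ᵐᵒᵖ c.I := SMulCommClass.symm _ _ _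
  refine brauer_of_end (I := c.I) (AlgEquiv.ofBijective (Algebra.lsmul C.F A₂ᵐᵒᵖ c.I) ⟨?_, ?_⟩)
  · rw [injective_iff_map_eq_zero]
    intro a ha
    have h1 : ∀ y : c.I, a • y = 0 := fun y => LinearMap.congr_fun ha y
    rw [← mul_one a, ← hvw, Finset.mul_sum]
    refine Finset.sum_eq_zero fun i _ => ?_
    rw [← c.μ_smul_left, h1, c.μ_zero_left]
  · intro h
    refine ⟨∑ i, c.μ (h (v i)) (w i), ?_⟩
    ext y
    change (∑ i, c.μ (h (v i)) (w i)) • y = h y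
    conv_rhs => rw [key y, map_sum]
    rw [Finset.sum_smul]
    refine Finset.sum_congr rfl fun i _ => ?_
    rw [c.assoc₁, map_smul]

end MoritaContext

namespace MoritaContext

variable {k : Type} [Field k] {C : AlgCurve k}
    {A₁ : Type} [Ring A₁] [Algebra C.F A₁] {A₂ : Type} [Ring A₂] [Algebra C.F A₂]
    {D₁ : SheafOrder C A₁} {D₂ : SheafOrder C A₂}

/-- transport of two-sided modules along the context -/
def tr (c : MoritaContext C A₁ A₂ D₁ D₂) (x : C.Point) (X : Submodule (C.O x) A₁) :
    Submodule (C.O x) A₂ :=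
  Submodule.span (C.O x) {b | ∃ w ∈ c.LJ x, ∃ a ∈ X, ∃ v ∈ c.LI x, b = c.ν w (a • v)}

variable (c : MoritaContext C A₁ A₂ D₁ D₂) {x : C.Point}

lemma tr_mem {X : Submodule (C.O x) A₁} {w : c.J} {a : A₁} {v : c.I} (hw : w ∈ c.LJ x)
    (ha : a ∈ X) (hv : v ∈ c.LI x) : c.ν w (a • v) ∈ c.tr x X :=
  Submodule.subset_span ⟨w, hw, a, ha, v, hv, rfl⟩

lemma tr_mono {X Y : Submodule (C.O x) A₁} (h : X ≤ Y) : c.tr x X ≤ c.tr x Y := by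
  apply Submodule.span_mono
  rintro _ ⟨w, hw, a, ha, v, hv, rfl⟩
  exact ⟨w, hw, a, h ha, v, hv, rfl⟩

lemma μ_mem {v : c.I} {w : c.J} (hv : v ∈ c.LI x) (hw : w ∈ c.LJ x) :
    c.μ v w ∈ (D₁.Λ x).toSubmodule := by
  rw [← c.μ_local x]; exact Submodule.subset_span ⟨v, hv, w, hw, rfl⟩

lemma ν_mem {v : c.I} {w : c.J} (hv : v ∈ c.LI x) (hw : w ∈ c.LJ x) :
    c.ν w v ∈ (D₂.Λ x).toSubmodule := c.symm.μ_mem hw hv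

lemma tr_mul (X Y : Submodule (C.O x) A₁) (hY : (D₁.Λ x).toSubmodule * Y ≤ Y) :
    c.tr x X * c.tr x Y ≤ c.tr x (X * Y) := by
  rw [tr, tr, Submodule.span_mul_span, Submodule.span_le]
  rintro _ ⟨_, ⟨w, hw, a, ha, v, hv, rfl⟩, _, ⟨w', hw', a', ha', v', hv', rfl⟩, rfl⟩
  have h : c.ν w (a • v) * c.ν w' (a' • v') = c.ν w ((a * (c.μ v w' * a')) • v') := by
    rw [← c.ν_smul_right, ← smul_comm, ← c.assoc₁, smul_smul, smul_smul, mul_assoc]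
  change c.ν w (a • v) * c.ν w' (a' • v') ∈ c.tr x (X * Y)
  rw [h]
  exact c.tr_mem hw (Submodule.mul_mem_mul ha (hY (Submodule.mul_mem_mul (c.μ_mem hv hw') ha'))) hv'

lemma tr_pow (X : Submodule (C.O x) A₁) (hX : (D₁.Λ x).toSubmodule * X ≤ X) (n : ℕ) :
    c.tr x X ^ (n + 1) ≤ c.tr x (X ^ (n + 1)) := by
  induction n with
  | zero => simp
  | succ n ih =>
    rw [pow_succ, pow_succ X]
    exact (mul_le_mul_left ih _).trans (c.tr_mul _ _ hX)

lemma tr_order : c.tr x (D₁.Λ x).toSubmodule = (D₂.Λ x).toSubmodule := by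
  apply le_antisymm
  · rw [tr, Submodule.span_le]
    rintro _ ⟨w, hw, a, ha, v, hv, rfl⟩
    exact c.ν_mem (c.stabI_left x a ha v hv) hw
  · rw [← c.ν_local x, Submodule.span_le]
    rintro _ ⟨w, hw, v, hv, rfl⟩
    have := c.tr_mem hw (show (1 : A₁) ∈ (D₁.Λ x).toSubmodule from (D₁.Λ x).one_mem) hv
    rwa [one_smul] at this

lemma ν_F (f : C.F) (w : c.J) (v : c.I) : c.ν w (f • v) = f • c.ν w v := by
  have h : f • v = MulOpposite.op (f • (1 : A₂)) • v := by
    rw [MulOpposite.op_smul, smul_assoc, MulOpposite.op_one, one_smul]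
  rw [h, c.ν_smul_right, mul_smul_comm, mul_one]

lemma tr_fs_le (f : C.F) (X : Submodule (C.O x) A₁) : c.tr x (fs f X) ≤ fs f (c.tr x X) := by
  rw [tr, Submodule.span_le]
  rintro _ ⟨w, hw, _, ⟨a, ha, rfl⟩, v, hv, rfl⟩
  exact ⟨_, c.tr_mem hw ha hv, by rw [smul_assoc, c.ν_F]⟩

lemma fs_tr_le (f : C.F) (X : Submodule (C.O x) A₁) : fs f (c.tr x X) ≤ c.tr x (fs f X) := by
  rintro _ ⟨y, hy, rfl⟩
  induction hy using Submodule.span_induction with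
  | mem y hy =>
    obtain ⟨w, hw, a, ha, v, hv, rfl⟩ := hy
    rw [← c.ν_F, ← smul_assoc]
    exact c.tr_mem hw (fs_mem ha) hv
  | zero => rw [smul_zero]; exact zero_mem _
  | add a b _ _ ha hb => rw [smul_add]; exact add_mem ha hb
  | smul r a _ ha => rw [fcomm]; exact Submodule.smul_mem _ _ ha

lemma tr_stab_left (X : Submodule (C.O x) A₁) : (D₂.Λ x).toSubmodule * c.tr x X ≤ c.tr x X := by
  rw [Submodule.mul_le]
  intro b hb y hy
  induction hy using Submodule.span_induction with
  | mem y hy =>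
    obtain ⟨w, hw, a, ha, v, hv, rfl⟩ := hy
    rw [← c.ν_smul_left]
    exact c.tr_mem (c.stabJ_left x b hb w hw) ha hv
  | zero => rw [mul_zero]; exact zero_mem _
  | add a b _ _ ha hb => rw [mul_add]; exact add_mem ha hb
  | smul r a _ ha => rw [mul_smul_comm]; exact Submodule.smul_mem _ _ ha

lemma tr_stab_right (X : Submodule (C.O x) A₁) : c.tr x X * (D₂.Λ x).toSubmodule ≤ c.tr x X := by
  rw [Submodule.mul_le]
  intro y hy b hb
  induction hy using Submodule.span_induction with
  | mem y hy =>
    obtain ⟨w, hw, a, ha, v, hv, rfl⟩ := hy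
    rw [← c.ν_smul_right, ← smul_comm]
    exact c.tr_mem hw ha (c.stabI_right x b hb v hv)
  | zero => rw [zero_mul]; exact zero_mem _
  | add a b _ _ ha hb => rw [add_mul]; exact add_mem ha hb
  | smul r a _ ha => rw [smul_mul_assoc]; exact Submodule.smul_mem _ _ ha

lemma μ_key (v v' : c.I) (w w' : c.J) (a : A₁) :
    c.μ v' (c.ν w (a • v) • w') = c.μ v' w * a * c.μ v w' := by
  rw [c.assoc₂, c.μ_smul_right, c.μ_smul_left, mul_assoc]

lemma tr_tr_le (X : Submodule (C.O x) A₁) (h1 : (D₁.Λ x).toSubmodule * X ≤ X)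
    (h2 : X * (D₁.Λ x).toSubmodule ≤ X) : c.symm.tr x (c.tr x X) ≤ X := by
  rw [tr, Submodule.span_le]
  suffices H : ∀ (v' : c.I) (w' : c.J) (b : A₂), v' ∈ c.LI x → b ∈ c.tr x X → w' ∈ c.LJ x →
      c.μ v' (b • w') ∈ X by
    rintro _ ⟨v', hv', b, hb, w', hw', rfl⟩
    exact H v' w' b hv' hb hw'
  intro v' w' b hv' hb hw'
  induction hb using Submodule.span_induction with
  | mem y hy =>
    obtain ⟨w, hw, a, ha, v, hv, rfl⟩ := hy
    rw [c.μ_key]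
    exact h2 (Submodule.mul_mem_mul (h1 (Submodule.mul_mem_mul (c.μ_mem hv' hw) ha))
      (c.μ_mem hv hw'))
  | zero =>
    have : c.μ v' ((0 : A₂) • w') = 0 := by
      rw [zero_smul]; exact add_eq_left.1 ((c.μ_add_right v' 0 0).symm.trans (by rw [add_zero]))
    rw [this]; exact zero_mem _
  | add a b _ _ ha hb => rw [add_smul, c.μ_add_right]; exact add_mem ha hb
  | smul r a _ ha =>
    have h : c.μ v' ((r • a) • w') = r • c.μ v' (a • w') := by
      have h3 := c.symm.ν_F (r : C.F) v' (a • w')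
      have h4 : (r • a) • w' = (r : C.F) • (a • w') := smul_assoc (r : C.F) a w'
      rw [h4]; exact h3
    rw [h]; exact Submodule.smul_mem _ _ ha

lemma le_tr_tr (X : Submodule (C.O x) A₁) : X ≤ c.symm.tr x (c.tr x X) := by
  have h1 : X ≤ (D₁.Λ x).toSubmodule * X * (D₁.Λ x).toSubmodule := by
    intro a ha
    have h1 : (1 : A₁) ∈ (D₁.Λ x).toSubmodule := (D₁.Λ x).one_mem
    have := Submodule.mul_mem_mul (Submodule.mul_mem_mul h1 ha) h1
    rwa [one_mul, mul_one] at this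
  refine h1.trans ?_
  rw [← c.μ_local x]
  conv_lhs => rw [← Submodule.span_eq X, Submodule.span_mul_span, Submodule.span_mul_span]
  rw [Submodule.span_le]
  rintro _ ⟨_, ⟨_, ⟨v', hv', w, hw, rfl⟩, a, ha, rfl⟩, _, ⟨v, hv, w', hw', rfl⟩, rfl⟩
  change c.μ v' w * a * c.μ v w' ∈ _
  rw [← c.μ_key]
  exact c.symm.tr_mem (X := c.tr x X) hv' (c.tr_mem hw ha hv) hw'

section
variable [Algebra.IsCentral C.F A₁] [Nontrivial A₁] [Algebra.IsCentral C.F A₂] [Nontrivial A₂]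

lemma tr_rad_le (h₁ : D₁.IsHereditary) (h₂ : D₂.IsHereditary) (x : C.Point) :
    c.tr x (radSubG (C.O x) A₁ (D₁.Λ x)) ≤ radSubG (C.O x) A₂ (D₂.Λ x) := by
  obtain ⟨p, hp0, hp⟩ := C.exists_unif x
  have H₁ := D₁.hOrd_self h₁ p hp0 hp
  have H₂ := D₂.hOrd_self h₂ p hp0 hp
  obtain ⟨n, hn, hpw⟩ := H₁.pw
  obtain ⟨n, rfl⟩ := Nat.exists_eq_succ_of_ne_zero hn.ne'
  refine H₂.semiprime ?_ (c.tr_stab_left _) (c.tr_stab_right _) (n + 1) ?_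
  · rw [← c.tr_order]; exact c.tr_mono H₁.P_le
  · refine (c.tr_pow _ H₁.SP n).trans ((c.tr_mono hpw).trans ((c.tr_fs_le _ _).trans ?_))
    rw [c.tr_order]; exact H₂.piS

lemma tr_rad (h₁ : D₁.IsHereditary) (h₂ : D₂.IsHereditary) (x : C.Point) :
    c.tr x (radSubG (C.O x) A₁ (D₁.Λ x)) = radSubG (C.O x) A₂ (D₂.Λ x) :=
  le_antisymm (c.tr_rad_le h₁ h₂ x)
    ((c.symm.le_tr_tr _).trans (c.tr_mono (c.symm.tr_rad_le h₂ h₁ x)))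

theorem index_imp (c : MoritaContext C A₁ A₂ D₁ D₂) (h₁ : D₁.IsHereditary) (h₂ : D₂.IsHereditary) (x : C.Point) (e : ℕ)
    (he : D₁.HasIndexAt x e) : D₂.HasIndexAt x e := by
  obtain ⟨p, hp0, hp⟩ := C.exists_unif x
  have H₁ := D₁.hOrd_self h₁ p hp0 hp
  have H₂ := D₂.hOrd_self h₂ p hp0 hp
  rw [D₁.hasIndexAt_iff h₁ p hp0 hp] at he
  rw [D₂.hasIndexAt_iff h₂ p hp0 hp]
  obtain ⟨he0, he⟩ := he
  obtain ⟨n, rfl⟩ := Nat.exists_eq_succ_of_ne_zero he0.ne'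
  have hfs : c.tr x (fs (algebraMap (C.O x) C.F p) (D₁.Λ x).toSubmodule) =
      fs (algebraMap (C.O x) C.F p) (D₂.Λ x).toSubmodule := by
    rw [← c.tr_order]; exact le_antisymm (c.tr_fs_le _ _) (c.fs_tr_le _ _)
  refine ⟨he0, le_antisymm ?_ ?_⟩
  · rw [← hfs, ← he, ← c.tr_rad h₁ h₂]
    exact c.tr_pow _ H₁.SP n
  · rw [← hfs, ← he, ← c.symm.tr_rad h₂ h₁]
    refine (c.tr_mono (c.symm.tr_pow _ H₂.SP n)).trans (c.symm.tr_tr_le _ ?_ ?_)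
    · rw [pow_succ', ← mul_assoc]; exact mul_le_mul_left H₂.SP _
    · rw [pow_succ, mul_assoc]; exact mul_le_mul_right H₂.PS _

end

end MoritaContext

theorem sheaf_orders_morita_equivalent_iff
    (k : Type) [Field k] [PerfectField k] (C : AlgCurve k)
    (A₁ : Type) [Ring A₁] [Algebra C.F A₁]
    [Algebra.IsCentral C.F A₁] [IsSimpleRing A₁] [FiniteDimensional C.F A₁]
    (A₂ : Type) [Ring A₂] [Algebra C.F A₂]
    [Algebra.IsCentral C.F A₂] [IsSimpleRing A₂] [FiniteDimensional C.F A₂]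
    (D₁ : SheafOrder C A₁) (h₁ : D₁.IsHereditary)
    (D₂ : SheafOrder C A₂) (h₂ : D₂.IsHereditary) :
    Nonempty (MoritaContext C A₁ A₂ D₁ D₂) ↔
      (BrauerEquivalent C.F A₁ A₂ ∧
        ∀ (x : C.Point) (e : ℕ), D₁.HasIndexAt x e ↔ D₂.HasIndexAt x e) := by
  constructor
  · rintro ⟨c⟩
    exact ⟨c.brauer, fun x e => ⟨c.index_imp h₁ h₂ x e, c.symm.index_imp h₂ h₁ x e⟩⟩
  · rintro ⟨hB, hidx⟩
    exact morita_of_brauer C A₁ A₂ D₁ h₁ D₂ h₂ hB hidx
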